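/- arXiv:1003.0475 — 5 statements merged into one kernel-verified Lean document; each statement's English description precedes it below -/
import Mathlib

section
/- Let n ≥ 2 and let W be a nonzero linear subspace of polynomial functions on N, all of whose elements are homogeneous of degree n(n−1)/2 and vanish identically on F, such that W is stable under the SO_n-action. Then W has a basis f_1, …, f_m such that δ(A) = f_1(A)² + ⋯ + f_m(A)² for all A ∈ N. -/
open Matrix BigOperators

/-- A real symmetric matrix is Hermitian. -/
theorem isHermitian_of_isSymm {n : ℕ} {A : Matrix (Fin n) (Fin n) ℝ} (h : A.IsSymm) :
    A.IsHermitian := by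
  rw [Matrix.IsHermitian, Matrix.conjTranspose_eq_transpose_of_trivial]
  exact h

/-- The discriminant of a real symmetric (Hermitian) matrix: the product of the squared
differences of its eigenvalues. -/
noncomputable def disc {n : ℕ} (A : Matrix (Fin n) (Fin n) ℝ) (hA : A.IsHermitian) : ℝ :=
  ∏ i : Fin n, ∏ j ∈ Finset.Ioi i, (hA.eigenvalues i - hA.eigenvalues j) ^ 2

/-- The space `N` of trace-zero real symmetric `n × n` matrices, as a submodule. -/
def symTraceless (n : ℕ) : Submodule ℝ (Matrix (Fin n) (Fin n) ℝ) where
  carrier := {A | A.IsSymm ∧ A.trace = 0}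
  add_mem' := by
    rintro A B ⟨hA1, hA2⟩ ⟨hB1, hB2⟩
    refine ⟨?_, ?_⟩
    · rw [Matrix.IsSymm, Matrix.transpose_add, hA1, hB1]
    · rw [Matrix.trace_add, hA2, hB2, add_zero]
  zero_mem' := ⟨by rw [Matrix.IsSymm, Matrix.transpose_zero], by simp⟩
  smul_mem' := by
    rintro c A ⟨h1, h2⟩
    refine ⟨?_, ?_⟩
    · rw [Matrix.IsSymm, Matrix.transpose_smul, h1]
    · rw [Matrix.trace_smul, h2, smul_zero]

theorem mem_symTraceless {n : ℕ} {A : Matrix (Fin n) (Fin n) ℝ} :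
    A ∈ symTraceless n ↔ A.IsSymm ∧ A.trace = 0 := Iff.rfl

/-- The eigenvalues of a trace-zero real symmetric matrix. -/
noncomputable def eigsN {n : ℕ} (A : symTraceless n) : Fin n → ℝ :=
  (isHermitian_of_isSymm (mem_symTraceless.mp A.2).1).eigenvalues

/-- A trace-zero symmetric matrix is degenerate if it has a repeated eigenvalue. -/
def Degen {n : ℕ} (A : symTraceless n) : Prop :=
  ∃ i j : Fin n, i ≠ j ∧ eigsN A i = eigsN A j

/-- The discriminant, as a function on trace-zero symmetric matrices. -/
noncomputable def discN {n : ℕ} (A : symTraceless n) : ℝ :=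
  ∏ i : Fin n, ∏ j ∈ Finset.Ioi i, (eigsN A i - eigsN A j) ^ 2

/-- Evaluation of a polynomial in the matrix entries at a matrix. -/
noncomputable def evalMat {n : ℕ} (p : MvPolynomial (Fin n × Fin n) ℝ)
    (A : Matrix (Fin n) (Fin n) ℝ) : ℝ :=
  MvPolynomial.eval (fun ij => A ij.1 ij.2) p

/-- The action `A ↦ gᵀ A g` of an orthogonal matrix on trace-zero symmetric matrices. -/
def soConj {n : ℕ} (g : Matrix (Fin n) (Fin n) ℝ) (hg : gᵀ * g = 1)
    (A : symTraceless n) : symTraceless n :=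
  ⟨gᵀ * A.1 * g, by
    obtain ⟨h1, h2⟩ := mem_symTraceless.mp A.2
    refine mem_symTraceless.mpr ⟨?_, ?_⟩
    · rw [Matrix.IsSymm, Matrix.transpose_mul, Matrix.transpose_mul,
        Matrix.transpose_transpose, h1, Matrix.mul_assoc]
    · rw [Matrix.trace_mul_cycle, mul_eq_one_comm.mp hg,
        Matrix.one_mul, h2]⟩

/-- `H_i(A) = A^i - (Tr(A^i)/n)·I`. -/
noncomputable def Hmat {n : ℕ} (A : Matrix (Fin n) (Fin n) ℝ) (i : ℕ) :
    Matrix (Fin n) (Fin n) ℝ :=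
  A ^ i - ((A ^ i).trace / (n : ℝ)) • 1


section poly
open MvPolynomial

lemma aux_X_sub_X_dvd {n : ℕ} (i j : Fin n) (r : MvPolynomial (Fin n) ℝ) :
    (X i - X j) ∣ r - rename (Function.update id i j) r := by
  induction r using MvPolynomial.induction_on with
  | C a => simp
  | add p q hp hq =>
    rw [map_add, add_sub_add_comm]; exact dvd_add hp hq
  | mul_X p k hp =>
    rw [map_mul, rename_X]
    have : p * X k - rename (Function.update id i j) p * X (Function.update id i j k)
      = (p - rename (Function.update id i j) p) * X k
        + rename (Function.update id i j) p * (X k - X (Function.update id i j k)) := by ring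
    rw [this]
    refine dvd_add (hp.mul_right _) (Dvd.dvd.mul_left ?_ _)
    by_cases h : k = i
    · subst h; simp
    · simp [Function.update_of_ne h]

lemma aux_prod_dvd {n : ℕ} (q : MvPolynomial (Fin n) ℝ)
    (h : ∀ i j : Fin n, i < j → rename (Function.update id i j) q = 0)
    (s : Finset (Σ _ : Fin n, Fin n)) (hs : ∀ a ∈ s, a.1 < a.2) :
    (∏ a ∈ s, (X a.1 - X a.2 : MvPolynomial (Fin n) ℝ)) ∣ q := by
  induction s using Finset.induction_on with
  | empty => simp
  | insert a s ha ih =>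
    obtain ⟨r, hr⟩ := ih (fun b hb => hs b (Finset.mem_insert_of_mem hb))
    have ha' := hs a (Finset.mem_insert_self _ _)
    have h1 := h a.1 a.2 ha'
    rw [hr, map_mul, map_prod] at h1
    have h2 : rename (Function.update id a.1 a.2) r = 0 := by
      refine (mul_eq_zero.mp h1).resolve_left ?_
      refine Finset.prod_ne_zero_iff.mpr ?_
      intro b hb
      have hb' := hs b (Finset.mem_insert_of_mem hb)
      have hne : b ≠ a := fun h => ha (h ▸ hb)
      rw [map_sub, rename_X, rename_X, sub_ne_zero]
      intro h3
      have h4 := X_injective h3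
      obtain ⟨b1, b2⟩ := b
      obtain ⟨a1, a2⟩ := a
      simp only [Function.update_apply, id] at h4
      simp only at hb' ha'
      apply hne
      split_ifs at h4 <;> grind
    have h5 := aux_X_sub_X_dvd a.1 a.2 r
    rw [h2, sub_zero] at h5
    rw [Finset.prod_insert ha, hr, mul_comm]
    exact mul_dvd_mul_left _ h5

lemma aux_card (n : ℕ) : ((Finset.univ : Finset (Fin n)).sigma (fun i => Finset.Ioi i)).card
    = n * (n - 1) / 2 := by
  rw [Finset.card_sigma]
  simp only [Fin.card_Ioi]
  rw [Fin.sum_univ_eq_sum_range (fun i => n - 1 - i) n, Finset.sum_range_reflect (fun i => i) n,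
    Finset.sum_range_id]

lemma aux_vand {n : ℕ} (q : MvPolynomial (Fin n) ℝ) (hq : q.IsHomogeneous (n * (n - 1) / 2))
    (hv : ∀ (x : Fin n → ℝ) (i j : Fin n), i ≠ j → x i = x j → eval x q = 0) :
    ∃ c : ℝ, ∀ x : Fin n → ℝ, eval x q = c * ∏ i, ∏ j ∈ Finset.Ioi i, (x i - x j) := by
  have h1 : ∀ i j : Fin n, i < j → rename (Function.update id i j) q = 0 := by
    intro i j hij
    apply MvPolynomial.funext
    intro x
    rw [eval_rename, map_zero]
    apply hv _ i j hij.ne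
    simp [Function.update_of_ne hij.ne']
  obtain ⟨c, hc⟩ := aux_prod_dvd q h1 ((Finset.univ : Finset (Fin n)).sigma (fun i => Finset.Ioi i))
    (by simp)
  set V := ∏ a ∈ (Finset.univ : Finset (Fin n)).sigma (fun i => Finset.Ioi i),
    (X a.1 - X a.2 : MvPolynomial (Fin n) ℝ) with hV
  have hVh : V.IsHomogeneous (n * (n - 1) / 2) := by
    have := IsHomogeneous.prod ((Finset.univ : Finset (Fin n)).sigma (fun i => Finset.Ioi i))
      (fun a => (X a.1 - X a.2 : MvPolynomial (Fin n) ℝ)) (fun _ => 1)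
      (fun a _ => (isHomogeneous_X _ _).sub (isHomogeneous_X _ _))
    simpa [aux_card, -Finset.card_sigma] using this
  have hV0 : V ≠ 0 := by
    rw [hV, Finset.prod_ne_zero_iff]
    rintro ⟨a, b⟩ h
    simp only [Finset.mem_sigma, Finset.mem_Ioi] at h
    rw [sub_ne_zero]
    intro h'
    exact h.2.ne (X_injective h')
  have hcC : ∃ r, c = C r := by
    by_cases hc0 : c = 0
    · exact ⟨0, by simp [hc0]⟩
    refine ⟨_, totalDegree_eq_zero_iff_eq_C.mp ?_⟩
    have h2 := totalDegree_mul_of_isDomain hV0 hc0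
    rw [← hc, hVh.totalDegree hV0] at h2
    have := hq.totalDegree_le
    omega
  obtain ⟨r, rfl⟩ := hcC
  refine ⟨r, fun x => ?_⟩
  rw [hc, hV, map_mul, map_prod, Finset.prod_sigma]
  simp [mul_comm]
end poly

lemma aux_inv {V ι : Type*} [Fintype ι] [NormedAddCommGroup V] [InnerProductSpace ℝ V]
    [FiniteDimensional ℝ V] (ev' ev : V →ₗ[ℝ] ℝ) (T : V →ₗ[ℝ] V)
    (hT : ∀ f h : V, inner ℝ (T f) (T h) = inner ℝ f h) (hev : ∀ f, ev' f = ev (T f))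
    (b : OrthonormalBasis ι ℝ V) : ∑ i, ev' (b i) ^ 2 = ∑ i, ev (b i) ^ 2 := by
  let Ti : V →ₗᵢ[ℝ] V := T.isometryOfInner hT
  let Te : V ≃ₗᵢ[ℝ] V := Ti.toLinearIsometryEquiv rfl
  let r : V := (InnerProductSpace.toDual ℝ V).symm (LinearMap.toContinuousLinearMap ev)
  have hr : ∀ f : V, inner ℝ f r = ev f := by
    intro f
    rw [real_inner_comm, InnerProductSpace.toDual_symm_apply]
    rfl
  have h1 := b.sum_sq_inner_right r
  have h2 := (b.map Te).sum_sq_inner_right r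
  rw [← h1] at h2
  simp only [hr] at h2
  rw [← h2]
  refine Finset.sum_congr rfl fun i _ => ?_
  rw [hev]
  rfl

lemma aux_basis {X E : Type*} [NormedAddCommGroup E] [InnerProductSpace ℝ E]
    [FiniteDimensional ℝ E] [MeasurableSpace E] [BorelSpace E] (e : E → X)
    (he : Function.Surjective e) (W : Submodule ℝ (X → ℝ)) [FiniteDimensional ℝ W]
    (hc : ∀ f ∈ W, Continuous (fun x => f (e x)))
    (hhom : ∀ f ∈ W, (∀ y ∈ Metric.ball (0 : E) 1, f (e y) = 0) → ∀ x, f (e x) = 0)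
    (G : Set (X → X)) (hG : ∀ g ∈ G, ∃ φ : E ≃ₗᵢ[ℝ] E, ∀ x, e (φ x) = g (e x))
    (hst : ∀ g ∈ G, ∀ f ∈ W, (fun A => f (g A)) ∈ W) :
    ∃ (m : ℕ) (b : Module.Basis (Fin m) ℝ ↥W), ∀ g ∈ G, ∀ A : X,
      ∑ i, ((b i : X → ℝ) (g A)) ^ 2 = ∑ i, ((b i : X → ℝ) A) ^ 2 := by
  classical
  let I : W → W → ℝ := fun f h => ∫ x in Metric.ball (0 : E) 1, f.1 (e x) * h.1 (e x)
  have hint : ∀ f h : W, MeasureTheory.IntegrableOn (fun x => f.1 (e x) * h.1 (e x))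
      (Metric.ball (0 : E) 1) MeasureTheory.volume := by
    intro f h
    have : Continuous (fun x => f.1 (e x) * h.1 (e x)) := (hc _ f.2).mul (hc _ h.2)
    exact (this.continuousOn.integrableOn_compact (isCompact_closedBall (0 : E) 1)).mono_set
      Metric.ball_subset_closedBall
  let core : InnerProductSpace.Core ℝ W :=
    { inner := I
      conj_inner_symm := by
        intro f h
        simp only [I, conj_trivial, mul_comm]
      re_inner_nonneg := by
        intro f
        simp only [I, RCLike.re_to_real]
        exact MeasureTheory.integral_nonneg fun x => mul_self_nonneg _
      add_left := by
        intro f g h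
        simp only [I]
        rw [← MeasureTheory.integral_add (hint f h) (hint g h)]
        congr 1; ext x; simp [add_mul]
      smul_left := by
        intro f h r
        simp only [I, conj_trivial]
        rw [← MeasureTheory.integral_const_mul]
        congr 1; ext x; simp [mul_assoc]
      definite := by
        intro f hf
        simp only [I] at hf
        rw [MeasureTheory.setIntegral_eq_zero_iff_of_nonneg_ae
          (Filter.Eventually.of_forall fun x => mul_self_nonneg _) (hint f f)] at hf
        have h2 := MeasureTheory.Measure.eqOn_open_of_ae_eq hf Metric.isOpen_ball
          ((hc _ f.2).mul (hc _ f.2)).continuousOn continuousOn_const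
        have h3 := hhom f.1 f.2 (fun y hy => by simpa using h2 hy)
        ext A
        obtain ⟨x, rfl⟩ := he A
        exact h3 x }
  let _ : NormedAddCommGroup W := core.toNormedAddCommGroup
  let _ : InnerProductSpace ℝ W := InnerProductSpace.ofCore core.toCore
  have hinner : ∀ f h : W, inner ℝ f h = I f h := fun _ _ => rfl
  let b := stdOrthonormalBasis ℝ W
  refine ⟨_, b.toBasis, ?_⟩
  intro g hg A
  obtain ⟨φ, hφ⟩ := hG g hg
  let T : W →ₗ[ℝ] W :=
    { toFun := fun f => ⟨fun A => f.1 (g A), hst g hg _ f.2⟩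
      map_add' := fun _ _ => rfl
      map_smul' := fun _ _ => rfl }
  have hT : ∀ f h : W, inner ℝ (T f) (T h) = inner ℝ f h := by
    intro f h
    rw [hinner, hinner]
    have := (φ.measurePreserving).setIntegral_preimage_emb
      φ.toHomeomorph.measurableEmbedding (fun x => f.1 (e x) * h.1 (e x)) (Metric.ball (0:E) 1)
    have hp : φ ⁻¹' (Metric.ball (0:E) 1) = Metric.ball (0:E) 1 := by
      ext x; simp
    rw [hp] at this
    simp only [I, ← this, hφ]
    rfl
  let ev : X → W →ₗ[ℝ] ℝ := fun A =>
    { toFun := fun f => f.1 A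
      map_add' := fun _ _ => rfl
      map_smul' := fun _ _ => rfl }
  have := aux_inv (ev (g A)) (ev A) T hT (fun f => rfl) b
  simpa [ev] using this

lemma aux_diag {n : ℕ} (hn : 2 ≤ n) (A : symTraceless n) :
    ∃ (g : Matrix (Fin n) (Fin n) ℝ) (hg : gᵀ * g = 1), g.det = 1 ∧
      (soConj g hg A).1 = diagonal (eigsN A) := by
  have hA := isHermitian_of_isSymm (mem_symTraceless.mp A.2).1
  have key := hA.conjStarAlgAut_star_eigenvectorUnitary
  set U : Matrix (Fin n) (Fin n) ℝ := hA.eigenvectorUnitary.1 with hU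
  have hUU : Uᵀ * U = 1 := by
    have := Unitary.coe_star_mul_self hA.eigenvectorUnitary
    rwa [star_eq_conjTranspose, conjTranspose_eq_transpose_of_trivial] at this
  have hd : Uᵀ * A.1 * U = diagonal (eigsN A) := by
    rw [Unitary.conjStarAlgAut_star_apply, star_eq_conjTranspose,
      conjTranspose_eq_transpose_of_trivial] at key
    exact key
  have hdet : U.det = 1 ∨ U.det = -1 := by
    have := congrArg det hUU
    rw [det_mul, det_transpose, det_one] at this
    exact mul_self_eq_one_iff.mp this
  let i0 : Fin n := ⟨0, by omega⟩
  let v : Fin n → ℝ := Function.update 1 i0 U.det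
  have hv : ∀ i, v i * v i = 1 := by
    intro i
    by_cases h : i = i0
    · subst h; rcases hdet with h | h <;> simp [v, h]
    · simp [v, Function.update_of_ne h]
  have hg : (U * diagonal v)ᵀ * (U * diagonal v) = 1 := by
    rw [transpose_mul, diagonal_transpose, Matrix.mul_assoc, ← Matrix.mul_assoc Uᵀ, hUU,
      Matrix.one_mul, diagonal_mul_diagonal]
    simp [hv]
  refine ⟨U * diagonal v, hg, ?_, ?_⟩
  · rw [det_mul, det_diagonal, Finset.prod_update_of_mem (Finset.mem_univ _)]
    rcases hdet with h | h <;> simp [h]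
  · have : (U * diagonal v)ᵀ * A.1 * (U * diagonal v)
        = diagonal v * (Uᵀ * A.1 * U) * diagonal v := by
      rw [transpose_mul, diagonal_transpose]; simp only [Matrix.mul_assoc]
    change (U * diagonal v)ᵀ * A.1 * (U * diagonal v) = _
    rw [this, hd, diagonal_mul_diagonal, diagonal_mul_diagonal]
    congr 1; ext i
    linear_combination (eigsN A i) * hv i

lemma aux_degen {n : ℕ} (A : symTraceless n) (l : Fin n → ℝ) (hA : A.1 = diagonal l)
    (i j : Fin n) (hij : i ≠ j) (h : l i = l j) : Degen A := by
  by_contra hD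
  have hinj : Function.Injective (eigsN A) := by
    intro a b hab
    by_contra hne
    exact hD ⟨a, b, hne, hab⟩
  have h1 := (isHermitian_of_isSymm (mem_symTraceless.mp A.2).1).roots_charpoly_eq_eigenvalues
  have h2 : A.1.charpoly.roots = Multiset.map l Finset.univ.val := by
    rw [hA, charpoly_diagonal, Polynomial.roots_prod]
    · simp
    · simp [Finset.prod_ne_zero_iff, Polynomial.X_sub_C_ne_zero]
  rw [h2] at h1
  have h3 : (Multiset.map l Finset.univ.val).Nodup := by
    rw [h1]
    exact Finset.univ.nodup.map hinj
  exact hij (Multiset.inj_on_of_nodup_map h3 i (Finset.mem_univ i) j (Finset.mem_univ j) h)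

lemma aux_trace (n : ℕ) (A : Matrix (Fin n) (Fin n) ℝ) :
    (Aᵀ * A).trace = ∑ p : Fin n × Fin n, A p.1 p.2 ^ 2 := by
  rw [Fintype.sum_prod_type, Finset.sum_comm]
  simp [trace, mul_apply, sq]

lemma aux_fin (n d : ℕ) (W : Submodule ℝ (↥(symTraceless n) → ℝ))
    (hWhom : ∀ f ∈ W, ∃ p : MvPolynomial (Fin n × Fin n) ℝ,
      p.IsHomogeneous d ∧ ∀ A : ↥(symTraceless n), f A = evalMat p A.1) :
    FiniteDimensional ℝ W := by
  let L : MvPolynomial (Fin n × Fin n) ℝ →ₗ[ℝ] (↥(symTraceless n) → ℝ) :=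
    { toFun := fun p A => evalMat p A.1
      map_add' := fun p q => by ext A; simp [evalMat]
      map_smul' := fun c p => by ext A; simp [evalMat] }
  have h1 := (MvPolynomial.homogeneousSubmodule_fg (σ := Fin n × Fin n) (R := ℝ) d).map L
  have h2 : W ≤ (MvPolynomial.homogeneousSubmodule (Fin n × Fin n) ℝ d).map L := by
    intro f hf
    obtain ⟨p, hp, hfp⟩ := hWhom f hf
    exact ⟨p, hp, by ext A; exact (hfp A).symm⟩
  have : FiniteDimensional ℝ ((MvPolynomial.homogeneousSubmodule (Fin n × Fin n) ℝ d).map L) :=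
    Module.Finite.iff_fg.mpr h1
  exact Submodule.finiteDimensional_of_le h2

/-- Euclidean model of the matrix space. -/
def auxL (n : ℕ) : EuclideanSpace ℝ (Fin n × Fin n) →ₗ[ℝ] Matrix (Fin n) (Fin n) ℝ where
  toFun x := Matrix.of fun i j => x (i, j)
  map_add' _ _ := rfl
  map_smul' _ _ := rfl

/-- Euclidean model of the traceless symmetric matrices. -/
abbrev auxE (n : ℕ) : Submodule ℝ (EuclideanSpace ℝ (Fin n × Fin n)) :=
  (symTraceless n).comap (auxL n)

lemma aux_norm (n : ℕ) (x : EuclideanSpace ℝ (Fin n × Fin n)) :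
    ‖x‖ ^ 2 = ((auxL n x)ᵀ * auxL n x).trace := by
  rw [aux_trace, EuclideanSpace.norm_sq_eq]
  simp only [Real.norm_eq_abs, sq_abs]
  rfl

lemma aux_phi (n : ℕ) (g : Matrix (Fin n) (Fin n) ℝ) (hg : gᵀ * g = 1) :
    ∃ φ : auxE n ≃ₗᵢ[ℝ] auxE n, ∀ x : auxE n,
      (⟨auxL n (φ x).1, (φ x).2⟩ : symTraceless n) = soConj g hg ⟨auxL n x.1, x.2⟩ := by
  let T : auxE n →ₗ[ℝ] auxE n :=
    { toFun := fun x => ⟨WithLp.toLp 2 fun p => (gᵀ * auxL n x.1 * g) p.1 p.2,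
        (soConj g hg ⟨auxL n x.1, x.2⟩).2⟩
      map_add' := by
        intro x y
        ext p
        simp [Matrix.mul_add, Matrix.add_mul]
      map_smul' := by
        intro c x
        ext p
        simp }
  have hTL : ∀ x, auxL n (T x).1 = gᵀ * auxL n x.1 * g := fun x => rfl
  let Ti : auxE n →ₗᵢ[ℝ] auxE n :=
    { T with
      norm_map' := by
        intro x
        change ‖(T x).1‖ = ‖x.1‖
        rw [← sq_eq_sq₀ (norm_nonneg _) (norm_nonneg _), aux_norm, aux_norm, hTL]
        have hg' : g * gᵀ = 1 := mul_eq_one_comm.mp hg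
        have : (gᵀ * auxL n x.1 * g)ᵀ * (gᵀ * auxL n x.1 * g)
            = gᵀ * ((auxL n x.1)ᵀ * (g * gᵀ) * auxL n x.1) * g := by
          simp only [transpose_mul, transpose_transpose, Matrix.mul_assoc]
        rw [this, hg', Matrix.mul_one, trace_mul_cycle, hg', Matrix.one_mul] }
  exact ⟨Ti.toLinearIsometryEquiv rfl, fun x => rfl⟩

lemma aux_evalhom {n d : ℕ} (p : MvPolynomial (Fin n × Fin n) ℝ) (hp : p.IsHomogeneous d)
    (t : ℝ) (A : Matrix (Fin n) (Fin n) ℝ) : evalMat p (t • A) = t ^ d * evalMat p A := by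
  unfold evalMat
  rw [MvPolynomial.eval_eq, MvPolynomial.eval_eq, Finset.mul_sum]
  refine Finset.sum_congr rfl fun m hm => ?_
  have hdeg := hp.degree_eq_sum_deg_support hm
  simp only [Matrix.smul_apply, smul_eq_mul, mul_pow, Finset.prod_mul_distrib, Finset.prod_pow_eq_pow_sum]
  rw [hdeg]
  ring

lemma aux_diagpoly {n : ℕ} (hn : 2 ≤ n) (f : symTraceless n → ℝ)
    (hf : ∃ p : MvPolynomial (Fin n × Fin n) ℝ,
      p.IsHomogeneous (n * (n - 1) / 2) ∧ ∀ A : ↥(symTraceless n), f A = evalMat p A.1)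
    (hv : ∀ A : ↥(symTraceless n), Degen A → f A = 0) :
    ∃ c : ℝ, ∀ (A : symTraceless n) (l : Fin n → ℝ), A.1 = diagonal l →
      f A = c * ∏ i, ∏ j ∈ Finset.Ioi i, (l i - l j) := by
  obtain ⟨p, hp, hfp⟩ := hf
  let Y : Fin n → MvPolynomial (Fin n) ℝ := fun i =>
    MvPolynomial.X i - MvPolynomial.C (n : ℝ)⁻¹ * ∑ k, MvPolynomial.X k
  have hY : ∀ i, (Y i).IsHomogeneous 1 := fun i =>
    (MvPolynomial.isHomogeneous_X _ _).sub
      ((MvPolynomial.IsHomogeneous.sum _ _ _ fun k _ => MvPolynomial.isHomogeneous_X _ _).C_mul _)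
  let Z : Fin n × Fin n → MvPolynomial (Fin n) ℝ := fun ij => if ij.1 = ij.2 then Y ij.1 else 0
  have hZ : ∀ ij, (Z ij).IsHomogeneous 1 := by
    intro ij
    simp only [Z]
    split_ifs
    · exact hY _
    · exact MvPolynomial.isHomogeneous_zero _ _ _
  let q := MvPolynomial.aeval Z p
  have hq : q.IsHomogeneous (n * (n - 1) / 2) := by
    have := hp.aeval Z hZ
    rwa [one_mul] at this
  have hn0 : (n : ℝ) ≠ 0 := by positivity
  have hqe : ∀ l : Fin n → ℝ, MvPolynomial.eval l q
      = evalMat p (diagonal fun i => l i - (n : ℝ)⁻¹ * ∑ k, l k) := by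
    intro l
    simp only [q, evalMat]
    change MvPolynomial.eval l (MvPolynomial.bind₁ Z p) = _
    rw [MvPolynomial.eval, MvPolynomial.eval₂Hom_bind₁]
    congr 2
    ext ij
    simp only [Z, Y, diagonal_apply]
    split_ifs <;> simp
  have hmem : ∀ l : Fin n → ℝ, diagonal (fun i => l i - (n : ℝ)⁻¹ * ∑ k, l k) ∈ symTraceless n := by
    intro l
    refine mem_symTraceless.mpr ⟨isSymm_diagonal _, ?_⟩
    rw [trace_diagonal, Finset.sum_sub_distrib]
    simp [hn0]
  obtain ⟨c, hc⟩ := aux_vand q hq (by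
    intro l i j hij hl
    rw [hqe, ← hfp ⟨_, hmem l⟩]
    exact hv _ (aux_degen _ _ rfl i j hij (by simp [hl])))
  refine ⟨c, fun A l hA => ?_⟩
  have htr : ∑ k, l k = 0 := by
    have := (mem_symTraceless.mp A.2).2
    rwa [hA, trace_diagonal] at this
  rw [← hc, hqe, hfp, hA]
  simp [htr]

/-- Any nonzero `SO_n`-stable subspace of degree-`n(n-1)/2` homogeneous polynomial functions
on the space `N` of trace-zero real symmetric matrices, all of whose elements vanish on the
set `F` of degenerate matrices, has a basis `f_1, …, f_m` with
`δ = f_1² + ⋯ + f_m²` on `N`. -/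
theorem discriminant_eq_sum_sq_basis (n : ℕ) (hn : 2 ≤ n)
    (W : Submodule ℝ (↥(symTraceless n) → ℝ)) (hW0 : W ≠ ⊥)
    (hWhom : ∀ f ∈ W, ∃ p : MvPolynomial (Fin n × Fin n) ℝ,
      p.IsHomogeneous (n * (n - 1) / 2) ∧ ∀ A : ↥(symTraceless n), f A = evalMat p A.1)
    (hWvan : ∀ f ∈ W, ∀ A : ↥(symTraceless n), Degen A → f A = 0)
    (hWstab : ∀ (g : Matrix (Fin n) (Fin n) ℝ) (hg : gᵀ * g = 1), g.det = 1 →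
      ∀ f ∈ W, (fun A => f (soConj g hg A)) ∈ W) :
    ∃ (m : ℕ) (b : Module.Basis (Fin m) ℝ ↥W),
      ∀ A : ↥(symTraceless n), discN A = ∑ i, ((b i : ↥(symTraceless n) → ℝ) A) ^ 2 := by
  have hfin := aux_fin n _ W hWhom
  let e : auxE n → symTraceless n := fun x => ⟨auxL n x.1, x.2⟩
  have he : Function.Surjective e := by
    intro A
    exact ⟨⟨WithLp.toLp 2 fun p => A.1 p.1 p.2, A.2⟩, rfl⟩
  obtain ⟨m, b, hb⟩ := aux_basis e he W
    (by
      intro f hf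
      obtain ⟨p, hp, hfp⟩ := hWhom f hf
      simp only [hfp, evalMat, e]
      refine (MvPolynomial.continuous_eval p).comp ?_
      refine continuous_pi fun ij => ?_
      change Continuous fun x : auxE n => x.1 (ij.1, ij.2)
      fun_prop)
    (by
      intro f hf hball x
      obtain ⟨p, hp, hfp⟩ := hWhom f hf
      have hpos : 0 < ‖x‖ + 1 := by positivity
      have h1 := hball ((‖x‖ + 1)⁻¹ • x) (by
        rw [mem_ball_zero_iff, norm_smul, norm_inv, Real.norm_of_nonneg hpos.le,
          inv_mul_lt_iff₀ hpos]
        linarith)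
      rw [hfp] at h1 ⊢
      have h2 : (e ((‖x‖ + 1)⁻¹ • x)).1 = (‖x‖ + 1)⁻¹ • (e x).1 := rfl
      rw [h2, aux_evalhom p hp] at h1
      exact (mul_eq_zero.mp h1).resolve_left (by positivity))
    {φ | ∃ (g : Matrix (Fin n) (Fin n) ℝ) (hg : gᵀ * g = 1), g.det = 1 ∧ φ = soConj g hg}
    (by
      rintro _ ⟨g, hg, -, rfl⟩
      exact aux_phi n g hg)
    (by
      rintro _ ⟨g, hg, hd, rfl⟩
      exact hWstab g hg hd)
  choose c hc using fun i => aux_diagpoly hn (b i : symTraceless n → ℝ) (hWhom _ (b i).2)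
    (hWvan _ (b i).2)
  have hS : ∀ A : symTraceless n,
      ∑ i, ((b i : symTraceless n → ℝ) A) ^ 2 = (∑ i, c i ^ 2) * discN A := by
    intro A
    obtain ⟨g, hg, hd, hgA⟩ := aux_diag hn A
    rw [← hb (soConj g hg) ⟨g, hg, hd, rfl⟩ A, Finset.sum_mul]
    refine Finset.sum_congr rfl fun i _ => ?_
    rw [hc i _ _ hgA, mul_pow, discN]
    simp only [Finset.prod_pow]
  have hC0 : ∑ i, c i ^ 2 ≠ 0 := by
    intro h0
    apply hW0
    have hbz : ∀ i, b i = 0 := by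
      intro i
      ext A
      have h1 := hS A
      rw [h0, zero_mul, Finset.sum_eq_zero_iff_of_nonneg (fun _ _ => sq_nonneg _)] at h1
      simpa using h1 i (Finset.mem_univ i)
    have hm : IsEmpty (Fin m) := ⟨fun i => b.ne_zero i (hbz i)⟩
    have : Subsingleton W := b.repr.toEquiv.subsingleton
    exact (Submodule.subsingleton_iff_eq_bot).mp this
  have hCpos : 0 < ∑ i, c i ^ 2 :=
    lt_of_le_of_ne (Finset.sum_nonneg fun _ _ => sq_nonneg _) hC0.symm
  have hs : (√(∑ i, c i ^ 2))⁻¹ ≠ 0 := by positivity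
  refine ⟨m, b.isUnitSMul (w := fun _ => (√(∑ i, c i ^ 2))⁻¹) (fun _ => hs.isUnit), fun A => ?_⟩
  simp only [Module.Basis.isUnitSMul_apply, Submodule.coe_smul, Pi.smul_apply, smul_eq_mul, mul_pow]
  rw [← Finset.mul_sum, hS, inv_pow, Real.sq_sqrt hCpos.le, inv_mul_cancel_left₀ hC0]
end

section
/- Let n ≥ 2 and set D = C(2n−1, n−1) − C(2n−3, n−1). Then there exists a linear subspace W of polynomial functions on N with dim W = D such that every element of W is homogeneous of degree n(n−1)/2 and vanishes identically on F, and W is stable under the SO_n-action on polynomial functions on N. -/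
open Matrix BigOperators

open MvPolynomial

/-- Product-of-forms. -/
noncomputable def linF {n : ℕ} {R : Type*} [CommRing R] (M : Matrix (Fin n) (Fin n) R)
    (k : Fin n) : MvPolynomial (Fin n) R := ∑ j, C (M k j) * X j

/-- Krylov determinant. -/
noncomputable def PA {n : ℕ} {R : Type*} [CommRing R] (A : Matrix (Fin n) (Fin n) R) :
    MvPolynomial (Fin n) R :=
  Matrix.det (Matrix.of fun i j : Fin n => linF (A ^ (j : ℕ)) i)

theorem linF_mul {n : ℕ} {R : Type*} [CommRing R] (M L : Matrix (Fin n) (Fin n) R) (k : Fin n) :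
    linF (M * L) k = ∑ l, C (M k l) * linF L l := by
  simp only [linF, Matrix.mul_apply, map_sum, map_mul, Finset.sum_mul, Finset.mul_sum]
  rw [Finset.sum_comm]
  simp only [mul_assoc]

theorem linF_map {n : ℕ} {R R' : Type*} [CommRing R] [CommRing R'] (f : R →+* R')
    (M : Matrix (Fin n) (Fin n) R) (k : Fin n) :
    MvPolynomial.map f (linF M k) = linF (M.map f) k := by
  simp [linF]

theorem PA_map {n : ℕ} {R R' : Type*} [CommRing R] [CommRing R'] (f : R →+* R')
    (A : Matrix (Fin n) (Fin n) R) :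
    MvPolynomial.map f (PA A) = PA (A.map f) := by
  unfold PA
  rw [RingHom.map_det]
  congr 1
  ext i j : 2
  simp only [RingHom.mapMatrix_apply, Matrix.map_apply, Matrix.of_apply]
  rw [linF_map, Matrix.map_pow]

theorem linF_isHomogeneous {n : ℕ} {R : Type*} [CommRing R] (M : Matrix (Fin n) (Fin n) R)
    (k : Fin n) : (linF M k).IsHomogeneous 1 := by
  apply IsHomogeneous.sum
  intro i _
  exact isHomogeneous_C_mul_X _ _

theorem PA_isHomogeneous {n : ℕ} {R : Type*} [CommRing R] (A : Matrix (Fin n) (Fin n) R) :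
    (PA A).IsHomogeneous n := by
  unfold PA
  rw [Matrix.det_apply]
  apply IsHomogeneous.sum
  intro σ _
  have : (∏ i, (Matrix.of fun i j : Fin n => linF (A ^ (j : ℕ)) i) (σ i) i).IsHomogeneous n := by
    have := IsHomogeneous.prod Finset.univ (fun i : Fin n => (Matrix.of fun i j : Fin n => linF (A ^ (j : ℕ)) i) (σ i) i) (fun _ => 1)
      (fun i _ => linF_isHomogeneous _ _)
    simpa using this
  rw [← mem_homogeneousSubmodule] at this ⊢
  rw [Units.smul_def]
  exact zsmul_mem this _

theorem PA_spec {n : ℕ} {R : Type*} [CommRing R] (V U : Matrix (Fin n) (Fin n) R)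
    (hVU : U * V = 1) (d : Fin n → R) :
    PA (V * Matrix.diagonal d * U) =
      C (V.det * (Matrix.vandermonde d).det) * ∏ k, linF U k := by
  have hpow : ∀ j : ℕ, (V * Matrix.diagonal d * U) ^ j = V * (Matrix.diagonal (d ^ j) * U) := by
    intro j
    induction j with
    | zero =>
      have := mul_eq_one_comm.mp hVU
      simp [this]
    | succ j ih =>
      rw [pow_succ, ih]
      have : V * (Matrix.diagonal (d ^ j) * U) * (V * Matrix.diagonal d * U)
        = V * Matrix.diagonal (d ^ j) * (U * V) * Matrix.diagonal d * U := by
        simp only [Matrix.mul_assoc]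
      rw [this, hVU, Matrix.mul_one, Matrix.mul_assoc V, Matrix.diagonal_mul_diagonal, Matrix.mul_assoc,
        pow_succ]
      rfl
  have hK : (Matrix.of fun i j : Fin n => linF ((V * Matrix.diagonal d * U) ^ (j : ℕ)) i)
      = (C : R →+* MvPolynomial (Fin n) R).mapMatrix V * (Matrix.diagonal (linF U)
        * (C : R →+* MvPolynomial (Fin n) R).mapMatrix (Matrix.vandermonde d)) := by
    ext i j : 2
    rw [Matrix.of_apply, hpow, linF_mul, Matrix.mul_apply]
    congr 1
    refine Finset.sum_congr rfl fun l _ => ?_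
    rw [RingHom.mapMatrix_apply, Matrix.map_apply, Matrix.diagonal_mul]
    congr 1
    simp [linF, Finset.sum_mul, Matrix.vandermonde]
    refine Finset.sum_congr rfl fun k _ => ?_
    ring
  unfold PA
  rw [hK, Matrix.det_mul, Matrix.det_mul, Matrix.det_diagonal, ← RingHom.map_det, ← RingHom.map_det,
    map_mul]
  ring

theorem PA_conj {n : ℕ} (g A : Matrix (Fin n) (Fin n) ℝ) (hg : gᵀ * g = 1) (hd : g.det = 1) :
    PA (gᵀ * A * g) = bind₁ (linF g) (PA A) := by
  have hgt := mul_eq_one_comm.mp hg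
  have hpow : ∀ j : ℕ, (gᵀ * A * g) ^ j = gᵀ * (A ^ j * g) := by
    intro j
    induction j with
    | zero => simp [hg]
    | succ j ih =>
      rw [pow_succ, ih]
      have : gᵀ * (A ^ j * g) * (gᵀ * A * g)
        = gᵀ * A ^ j * (g * gᵀ) * A * g := by
        simp only [Matrix.mul_assoc]
      rw [this, hgt, Matrix.mul_one, pow_succ]
      simp only [Matrix.mul_assoc]
  have hK : (Matrix.of fun i j : Fin n => linF ((gᵀ * A * g) ^ (j : ℕ)) i)
      = (C : ℝ →+* MvPolynomial (Fin n) ℝ).mapMatrix gᵀ *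
        (bind₁ (linF g)).mapMatrix (Matrix.of fun i j : Fin n => linF (A ^ (j : ℕ)) i) := by
    ext i j : 2
    rw [Matrix.of_apply, hpow, linF_mul, Matrix.mul_apply]
    refine congrArg _ (Finset.sum_congr rfl fun l _ => ?_)
    rw [RingHom.mapMatrix_apply, Matrix.map_apply]
    refine congrArg _ ?_
    rw [linF_mul, AlgHom.mapMatrix_apply, Matrix.map_apply, Matrix.of_apply]
    conv_rhs => rw [linF, map_sum]
    refine Finset.sum_congr rfl fun k _ => ?_
    rw [map_mul, bind₁_C_right, bind₁_X_right]
  unfold PA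
  rw [hK, Matrix.det_mul, ← RingHom.map_det, ← AlgHom.map_det, Matrix.det_transpose, hd, map_one,
    one_mul]

theorem exists_spec {n : ℕ} (A : symTraceless n) : ∃ U : Matrix (Fin n) (Fin n) ℝ,
    U * Uᵀ = 1 ∧ A.1 = Uᵀ * Matrix.diagonal (eigsN A) * U := by
  set hA := isHermitian_of_isSymm (mem_symTraceless.mp A.2).1 with hAd
  refine ⟨(hA.eigenvectorUnitary : Matrix (Fin n) (Fin n) ℝ)ᵀ, ?_, ?_⟩
  · have := Unitary.coe_star_mul_self hA.eigenvectorUnitary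
    rw [Matrix.transpose_transpose]
    rw [Matrix.star_eq_conjTranspose, Matrix.conjTranspose_eq_transpose_of_trivial] at this
    exact this
  · have := hA.spectral_theorem
    rw [Unitary.conjStarAlgAut_apply, Matrix.star_eq_conjTranspose, Matrix.conjTranspose_eq_transpose_of_trivial] at this
    rw [Matrix.transpose_transpose]
    exact this

/-- coefficientwise homogeneity -/
def CH {n : ℕ} {σ : Type*} (d : ℕ) (p : MvPolynomial (Fin n) (MvPolynomial σ ℝ)) : Prop :=
  ∀ α, (coeff α p).IsHomogeneous d

theorem CH.mul {n : ℕ} {σ : Type*} {d e : ℕ} {p q : MvPolynomial (Fin n) (MvPolynomial σ ℝ)}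
    (hp : CH d p) (hq : CH e q) : CH (d + e) (p * q) := by
  intro α
  classical
  rw [coeff_mul]
  exact IsHomogeneous.sum _ _ _ fun x _ => (hp _).mul (hq _)

theorem CH.sum {n : ℕ} {σ ι : Type*} {d : ℕ} (s : Finset ι)
    (p : ι → MvPolynomial (Fin n) (MvPolynomial σ ℝ))
    (hp : ∀ i ∈ s, CH d (p i)) : CH d (∑ i ∈ s, p i) := by
  intro α
  rw [coeff_sum]
  exact IsHomogeneous.sum _ _ _ fun x hx => hp x hx _

theorem CH.prod {n : ℕ} {σ ι : Type*} {d : ι → ℕ} (s : Finset ι)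
    (p : ι → MvPolynomial (Fin n) (MvPolynomial σ ℝ))
    (hp : ∀ i ∈ s, CH (d i) (p i)) : CH (∑ i ∈ s, d i) (∏ i ∈ s, p i) := by
  classical
  induction s using Finset.induction_on with
  | empty =>
    intro α
    simp only [Finset.sum_empty, Finset.prod_empty, coeff_one]
    split_ifs
    · exact isHomogeneous_one _ _
    · exact isHomogeneous_zero _ _ _
  | insert a s ha ih =>
    rw [Finset.sum_insert ha, Finset.prod_insert ha]
    exact (hp a (by simp)).mul (ih fun i hi => hp i (by simp [hi]))

theorem CH_PA (n : ℕ) : CH (n * (n - 1) / 2)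
    (PA (Matrix.mvPolynomialX (Fin n) (Fin n) ℝ)) := by
  have hpow : ∀ (j : ℕ) (i k : Fin n),
      ((Matrix.mvPolynomialX (Fin n) (Fin n) ℝ ^ j) i k).IsHomogeneous j := by
    intro j
    induction j with
    | zero =>
      intro i k
      rw [pow_zero, Matrix.one_apply]
      split_ifs
      · exact isHomogeneous_one _ _
      · exact isHomogeneous_zero _ _ _
    | succ j ih =>
      intro i k
      rw [pow_succ, Matrix.mul_apply]
      exact IsHomogeneous.sum _ _ _ fun l _ => (ih i l).mul (isHomogeneous_X _ _)
  have hlin : ∀ (j : ℕ) (i : Fin n), CH j (linF (Matrix.mvPolynomialX (Fin n) (Fin n) ℝ ^ j) i) := by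
    intro j i
    apply CH.sum
    intro k _ α
    classical
    rw [coeff_C_mul, coeff_X]
    split_ifs
    · simpa using hpow j i k
    · simpa using isHomogeneous_zero _ _ _
  have hs : ∑ j : Fin n, (j : ℕ) = n * (n - 1) / 2 := by
    rw [Fin.sum_univ_eq_sum_range (fun j : ℕ => j) n, Finset.sum_range_id]
  unfold PA
  rw [Matrix.det_apply, ← hs]
  apply CH.sum
  intro σ _ α
  have := CH.prod Finset.univ (fun i : Fin n => (Matrix.of fun i j : Fin n =>
    linF (Matrix.mvPolynomialX (Fin n) (Fin n) ℝ ^ (j : ℕ)) i) (σ i) i) (d := fun i : Fin n => (i : ℕ))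
      (fun i _ => hlin _ _) α
  rw [Units.smul_def, ← lcoeff_apply (R := MvPolynomial (Fin n × Fin n) ℝ), map_zsmul]
  rw [← mem_homogeneousSubmodule] at this ⊢
  exact zsmul_mem this _

theorem coeff_PA_poly {n : ℕ} (α : Fin n →₀ ℕ) (A : Matrix (Fin n) (Fin n) ℝ) :
    coeff α (PA A) = evalMat (coeff α (PA (Matrix.mvPolynomialX (Fin n) (Fin n) ℝ))) A := by
  unfold evalMat
  rw [← coeff_map, PA_map]
  congr 2
  ext i j
  simp [Matrix.mvPolynomialX]

theorem pderiv_linF {n : ℕ} (U : Matrix (Fin n) (Fin n) ℝ) (k i : Fin n) :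
    pderiv i (linF U k) = C (U k i) := by
  unfold linF
  rw [map_sum, Finset.sum_eq_single i]
  · rw [pderiv_C_mul, pderiv_X_self, mul_one]
  · intro j _ hj
    rw [pderiv_C_mul, pderiv_X_of_ne hj, mul_zero]
  · simp

theorem dir_prod {n : ℕ} (U : Matrix (Fin n) (Fin n) ℝ) (hU : U * Uᵀ = 1) (a : Fin n)
    (s : Finset (Fin n)) (ha : a ∉ s) :
    ∑ i, C (U a i) * pderiv i (∏ k ∈ s, linF U k) = 0 := by
  classical
  induction s using Finset.induction_on with
  | empty => simp
  | insert b s hb ih =>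
    have hab : a ≠ b := by rintro rfl; simp at ha
    have has : a ∉ s := fun h => ha (by simp [h])
    have h1 := ih has
    have h2 : ∑ i, U a i * U b i = 0 := by
      have := congrFun (congrFun hU a) b
      rw [Matrix.mul_apply, Matrix.one_apply_ne hab] at this
      simpa using this
    have : ∀ i, C (U a i) * pderiv i (∏ k ∈ insert b s, linF U k)
        = C (U a i * U b i) * (∏ k ∈ s, linF U k)
          + linF U b * (C (U a i) * pderiv i (∏ k ∈ s, linF U k)) := by
      intro i
      rw [Finset.prod_insert hb, pderiv_mul, pderiv_linF, C_mul]
      ring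
    simp only [this]
    rw [Finset.sum_add_distrib, ← Finset.sum_mul, ← Finset.mul_sum, h1, ← map_sum, h2]
    simp

theorem lap_prod {n : ℕ} (U : Matrix (Fin n) (Fin n) ℝ) (hU : U * Uᵀ = 1)
    (s : Finset (Fin n)) :
    ∑ i, pderiv i (pderiv i (∏ k ∈ s, linF U k)) = 0 := by
  classical
  induction s using Finset.induction_on with
  | empty => simp
  | insert b s hb ih =>
    have : ∀ i, pderiv i (pderiv i (∏ k ∈ insert b s, linF U k))
        = 2 * (C (U b i) * pderiv i (∏ k ∈ s, linF U k))
          + linF U b * pderiv i (pderiv i (∏ k ∈ s, linF U k)) := by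
      intro i
      rw [Finset.prod_insert hb, pderiv_mul, pderiv_linF, map_add, pderiv_C_mul, pderiv_mul, 
        pderiv_linF]
      ring
    simp only [this]
    rw [Finset.sum_add_distrib, ← Finset.mul_sum, ← Finset.mul_sum, ih, dir_prod U hU b s hb]
    simp

theorem lap_PA {n : ℕ} (A : symTraceless n) (β : Fin n →₀ ℕ) :
    ∑ i, (((β i : ℝ) + 1) * ((β i : ℝ) + 2)) *
      coeff (β + Finsupp.single i 2) (PA A.1) = 0 := by
  obtain ⟨U, hU, hA⟩ := exists_spec A
  have h : ∑ i, pderiv i (pderiv i (PA A.1)) = 0 := by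
    rw [hA, PA_spec _ _ hU]
    simp only [pderiv_C_mul]
    rw [← Finset.mul_sum, lap_prod U hU, mul_zero]
  have := congrArg (coeff β) h
  rw [coeff_sum, coeff_zero] at this
  rw [← this]
  refine Finset.sum_congr rfl fun i _ => ?_
  rw [coeff_pderiv, coeff_pderiv, add_assoc, ← Finsupp.single_add]
  simp
  ring

theorem PA_degen {n : ℕ} (A : symTraceless n) (h : Degen A) : PA A.1 = 0 := by
  obtain ⟨U, hU, hA⟩ := exists_spec A
  obtain ⟨i, j, hij, he⟩ := h
  rw [hA, PA_spec _ _ hU, Matrix.det_vandermonde_eq_zero_iff.mpr ⟨i, j, he, hij⟩]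
  simp

theorem reduce {m : ℕ} {V : Type*} [AddCommGroup V] [Module ℝ V] (F : (Fin (m+1) →₀ ℕ) → V)
    (hF : ∀ β, ∑ i, (((β i : ℝ) + 1) * ((β i : ℝ) + 2)) • F (β + Finsupp.single i 2) = 0)
    (d : ℕ) (W : Submodule ℝ V) (hW : ∀ α, α.degree = d → α 0 ≤ 1 → F α ∈ W) :
    ∀ (k : ℕ) (α), α 0 = k → α.degree = d → F α ∈ W := by
  intro k
  induction k using Nat.strong_induction_on with
  | _ k ih =>
    intro α hk hd
    by_cases h1 : α 0 ≤ 1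
    · exact hW α hd h1
    · set β := α - Finsupp.single 0 2 with hβ
      have hαβ : α = β + Finsupp.single 0 2 := by
        rw [hβ, tsub_add_cancel_of_le]
        rw [Finsupp.single_le_iff]
        omega
      have hb0 : α 0 = β 0 + 2 := by rw [hαβ]; simp
      have hbd : β.degree + 2 = d := by rw [← hd, hαβ, map_add, Finsupp.degree_single]
      have h := hF β
      rw [Fin.sum_univ_succ, ← hαβ] at h
      have hmem : (((β 0 : ℝ) + 1) * ((β 0 : ℝ) + 2)) • F α ∈ W := by
        rw [eq_neg_of_add_eq_zero_left h]
        refine W.neg_mem (W.sum_mem fun i _ => W.smul_mem _ ?_)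
        refine ih (β 0) (by omega) _ ?_ ?_
        · simp
        · rw [map_add, Finsupp.degree_single, hbd]
      have hne : (((β 0 : ℝ) + 1) * ((β 0 : ℝ) + 2)) ≠ 0 := by positivity
      exact (W.smul_mem_iff hne).mp hmem

theorem card_S (m : ℕ) :
    (((Finset.univ : Finset (Fin (m+2))).finsuppAntidiag (m+2)).filter (fun α => α 0 ≤ 1)).card
      = Nat.choose (2 * (m+2) - 1) (m + 2 - 1) - Nat.choose (2 * (m+2) - 3) (m + 2 - 1) := by
  classical
  have h1 := Finset.card_finsuppAntidiag_nat_eq_choose (s := (Finset.univ : Finset (Fin (m+2)))) (m+2)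
  have h2 := Finset.card_finsuppAntidiag_nat_eq_choose (s := (Finset.univ : Finset (Fin (m+2)))) m
  have h3 := Finset.card_filter_add_card_filter_not (s := (Finset.univ : Finset (Fin (m+2))).finsuppAntidiag (m+2)) (fun α => α 0 ≤ 1)
  have h4 : (((Finset.univ : Finset (Fin (m+2))).finsuppAntidiag (m+2)).filter (fun α => ¬ α 0 ≤ 1)).card
     = ((Finset.univ : Finset (Fin (m+2))).finsuppAntidiag m).card := by
    symm
    refine Finset.card_bij' (fun α _ => α + Finsupp.single 0 2) (fun α _ => α - Finsupp.single 0 2) ?_ ?_ ?_ ?_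
    · intro α hα
      simp only [Finset.mem_filter, Finset.mem_finsuppAntidiag, Finset.subset_univ, and_true] at hα ⊢
      simp [Finset.sum_add_distrib, hα, Finsupp.single_apply]
    · intro α hα
      simp only [Finset.mem_filter, Finset.mem_finsuppAntidiag, Finset.subset_univ, and_true] at hα ⊢
      obtain ⟨ha, hb⟩ := hα
      rw [Fin.sum_univ_succ] at ha ⊢
      simp
      omega
    · intro α _
      simp
    · intro α hα
      simp only [Finset.mem_filter] at hα
      rw [tsub_add_cancel_of_le]
      rw [Finsupp.single_le_iff]
      omega
  simp only [Finset.card_univ, Fintype.card_fin] at h1 h2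
  have e1 : Nat.choose (2 * (m+2) - 1) (m + 2 - 1) = Nat.choose (m+2+(m+2)-1) (m+2) := by
    rw [← Nat.choose_symm_of_eq_add (a := m+2) (b := m+2-1)]
    · congr 1; omega
    · omega
  have e2 : Nat.choose (2 * (m+2) - 3) (m + 2 - 1) = Nat.choose (m+2+m-1) m := by
    rw [← Nat.choose_symm_of_eq_add (a := m) (b := m+2-1)]
    · congr 1; omega
    · omega
  rw [e1, e2, ← h1, ← h2, ← h4]
  omega

/-- the polarized functional -/
noncomputable def GG {n : ℕ} (S : Finset (Fin n →₀ ℕ)) (c : (Fin n →₀ ℕ) → ℝ) {R : Type*} [CommRing R]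
    [Algebra ℝ R] (M : Matrix (Fin n) (Fin n) R) : R :=
  ∑ α ∈ S, algebraMap ℝ R (c α) * coeff α (∏ k, linF M k)

theorem GG_map {n : ℕ} (S : Finset (Fin n →₀ ℕ)) (c : (Fin n →₀ ℕ) → ℝ) {R R' : Type*} [CommRing R]
    [Algebra ℝ R] [CommRing R'] [Algebra ℝ R'] (f : R →ₐ[ℝ] R') (M : Matrix (Fin n) (Fin n) R) :
    f (GG S c M) = GG S c (M.map f) := by
  unfold GG
  rw [map_sum]
  refine Finset.sum_congr rfl fun α _ => ?_
  rw [map_mul, AlgHom.commutes]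
  congr 1
  have := coeff_map (f : R →+* R') (∏ k, linF M k) α
  rw [map_prod] at this
  simp only [linF_map] at this
  exact this.symm

theorem GG_smul {n : ℕ} (S : Finset (Fin n →₀ ℕ)) (c : (Fin n →₀ ℕ) → ℝ) {R : Type*} [CommRing R]
    [Algebra ℝ R] (v : Fin n → R) (M : Matrix (Fin n) (Fin n) R) :
    GG S c (Matrix.of fun k j => v k * M k j) = (∏ k, v k) * GG S c M := by
  unfold GG
  rw [Finset.mul_sum]
  refine Finset.sum_congr rfl fun α _ => ?_
  have : ∀ k, linF (Matrix.of fun k j => v k * M k j) k = C (v k) * linF M k := by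
    intro k
    simp [linF, Finset.mul_sum, mul_assoc]
  simp only [this]
  rw [Finset.prod_mul_distrib, ← map_prod, coeff_C_mul]
  ring

theorem GG_orth {n : ℕ} (S : Finset (Fin n →₀ ℕ)) (c : (Fin n →₀ ℕ) → ℝ)
    (hc : ∀ A : symTraceless n, ∑ α ∈ S, c α * coeff α (PA A.1) = 0)
    (U : Matrix (Fin n) (Fin n) ℝ) (hU : U * Uᵀ = 1) : GG S c U = 0 := by
  have hUt := mul_eq_one_comm.mp hU
  set μ : ℝ := (∑ k : Fin n, (k : ℝ)) / n with hμ
  set d : Fin n → ℝ := fun k => (k : ℝ) - μ with hd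
  have hdi : Function.Injective d := by
    intro i j hij
    simp only [hd, sub_left_inj, Nat.cast_inj] at hij
    exact Fin.ext hij
  have hmem : Uᵀ * Matrix.diagonal d * U ∈ symTraceless n := by
    refine mem_symTraceless.mpr ⟨?_, ?_⟩
    · rw [Matrix.IsSymm]
      simp [Matrix.transpose_mul, Matrix.mul_assoc]
    · rw [Matrix.trace_mul_cycle, hU, Matrix.one_mul, Matrix.trace_diagonal]
      simp only [hd, Finset.sum_sub_distrib, Finset.sum_const, Finset.card_univ, Fintype.card_fin,
        nsmul_eq_mul]
      rcases Nat.eq_zero_or_pos n with h0 | h0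
      · subst h0; simp
      · rw [hμ]
        have : (n : ℝ) ≠ 0 := by positivity
        field_simp
        ring
  have h := hc ⟨_, hmem⟩
  simp only [PA_spec _ _ hU, coeff_C_mul] at h
  set κ := Uᵀ.det * (Matrix.vandermonde d).det with hκ
  have hκ0 : κ ≠ 0 := by
    refine mul_ne_zero ?_ (Matrix.det_vandermonde_ne_zero_iff.mpr hdi)
    intro h0
    have := congrArg Matrix.det hU
    rw [Matrix.det_mul, h0] at this
    simp at this
  have h2 : κ * GG S c U = 0 := by
    rw [← h, GG, Finset.mul_sum]
    refine Finset.sum_congr rfl fun α _ => ?_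
    simp only [Algebra.algebraMap_self, RingHom.id_apply]
    ring
  exact (mul_eq_zero.mp h2).resolve_left hκ0

theorem exists_householder (m : ℕ) : ∃ H : Matrix (Fin (m+1)) (Fin (m+1)) ℝ, H * Hᵀ = 1 ∧
    ∀ k, H k 0 ≠ 0 := by
  set v : Fin (m+1) → ℝ := Fin.cons 1 (fun _ => 2) with hv
  have hvv : v ⬝ᵥ v = 1 + 4 * m := by
    simp [dotProduct, Fin.sum_univ_succ, hv]
    ring
  set q : ℝ := 1 + 4 * m with hq
  have hq0 : q ≠ 0 := by positivity
  have hq1 : 1 ≤ q := by rw [hq]; have : (0:ℝ) ≤ m := by positivity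
                         linarith
  refine ⟨1 - (2 / q) • Matrix.vecMulVec v v, ?_, ?_⟩
  · have ht : (1 - (2 / q) • Matrix.vecMulVec v v)ᵀ = 1 - (2 / q) • Matrix.vecMulVec v v := by
      ext i j
      simp [Matrix.vecMulVec_apply, Matrix.one_apply, mul_comm, eq_comm]
    rw [ht]
    have : Matrix.vecMulVec v v * Matrix.vecMulVec v v = q • Matrix.vecMulVec v v := by
      rw [Matrix.vecMulVec_mul_vecMulVec, hvv]
      ext i j
      simp [Matrix.vecMulVec_apply]; ring
    simp only [sub_mul, mul_sub, Matrix.smul_mul, Matrix.mul_smul, this, Matrix.one_mul, Matrix.mul_one]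
    ext i j
    simp
    field_simp
    ring
  · intro k
    refine Fin.cases ?_ (fun k => ?_) k
    · simp [Matrix.vecMulVec_apply, hv]
      intro h
      have : m = 0 ∨ 1 ≤ m := by omega
      field_simp at h
      have h5 : (1 + 4 * m : ℕ) = (2 : ℕ) := by
        have : (1 + 4 * (m:ℝ)) = 2 := by rw [← hq]; linarith
        exact_mod_cast this
      omega
    · simp [Matrix.vecMulVec_apply, hv, hq0]

theorem GG_isotropic {m : ℕ} (S : Finset (Fin (m+1) →₀ ℕ)) (c : (Fin (m+1) →₀ ℕ) → ℝ)
    (hc : ∀ A : symTraceless (m+1), ∑ α ∈ S, c α * coeff α (PA A.1) = 0)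
    (w : Fin (m+1) → ℝ) (hw0 : w 0 = 0) (hw : w ⬝ᵥ w = 1) :
    GG S c (Matrix.of fun _ j : Fin (m+1) =>
      (((Pi.single 0 1 : Fin (m+1) → ℝ) j : ℂ) + Complex.I * (w j : ℂ))) = 0 := by
  obtain ⟨H, hH, hH0⟩ := exists_householder m
  set e : Fin (m+1) → ℝ := Pi.single 0 1 with he
  have hee : e ⬝ᵥ e = 1 := by simp [he]
  have hew : e ⬝ᵥ w = 0 := by simp [he, hw0]
  have hwe : w ⬝ᵥ e = 0 := by simp [he, hw0]
  set B := Matrix.vecMulVec e w - Matrix.vecMulVec w e with hB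
  set E := Matrix.vecMulVec e e + Matrix.vecMulVec w w with hE
  have hBt : Bᵀ = -B := by
    ext i j; simp [hB, Matrix.vecMulVec_apply]; ring
  have hEt : Eᵀ = E := by
    ext i j; simp [hE, Matrix.vecMulVec_apply]; ring
  have hBB : B * B = -E := by
    simp only [hB, hE, sub_mul, mul_sub, Matrix.vecMulVec_mul_vecMulVec, hee, hew, hwe, hw]
    ext i j
    simp [Matrix.vecMulVec_apply]; ring
  have hEE : E * E = E := by
    simp only [hE, add_mul, mul_add, Matrix.vecMulVec_mul_vecMulVec, hee, hew, hwe, hw]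
    ext i j
    simp [Matrix.vecMulVec_apply]
  have hBE : B * E = B := by
    simp only [hB, hE, sub_mul, mul_add, Matrix.vecMulVec_mul_vecMulVec, hee, hew, hwe, hw]
    ext i j
    simp [Matrix.vecMulVec_apply]; ring
  have hEB : E * B = B := by
    simp only [hB, hE, add_mul, mul_sub, Matrix.vecMulVec_mul_vecMulVec, hee, hew, hwe, hw]
    ext i j
    simp [Matrix.vecMulVec_apply]
  -- rotation
  have hrot : ∀ t : ℝ, GG S c (H * ((1 + t ^ 2) • 1 + (2 * t) • B - (2 * t ^ 2) • E)) = 0 := by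
    intro t
    have hs : (1 + t ^ 2) ≠ 0 := by positivity
    set Rt := (1 + t ^ 2) • (1 : Matrix (Fin (m+1)) (Fin (m+1)) ℝ) + (2 * t) • B - (2 * t ^ 2) • E with hRt
    have hRR : Rt * Rtᵀ = (1 + t ^ 2) ^ 2 • 1 := by
      have : Rtᵀ = (1 + t ^ 2) • (1 : Matrix (Fin (m+1)) (Fin (m+1)) ℝ) - (2 * t) • B - (2 * t ^ 2) • E := by
        rw [hRt]
        simp only [Matrix.transpose_sub, Matrix.transpose_add, Matrix.transpose_smul, hBt, hEt,
          Matrix.transpose_one, smul_neg]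
        abel
      rw [this, hRt]
      simp only [sub_mul, add_mul, mul_sub, Matrix.smul_mul, Matrix.mul_smul, hBB, hEE, hBE, hEB, 
        Matrix.one_mul, Matrix.mul_one]
      module
    have hU : ((1 + t ^ 2)⁻¹ • (H * Rt)) * ((1 + t ^ 2)⁻¹ • (H * Rt))ᵀ = 1 := by
      rw [Matrix.transpose_smul, Matrix.transpose_mul, Matrix.smul_mul, Matrix.mul_smul]
      have : H * Rt * (Rtᵀ * Hᵀ) = H * (Rt * Rtᵀ) * Hᵀ := by simp only [Matrix.mul_assoc]
      rw [this, hRR, Matrix.mul_smul, Matrix.mul_one, Matrix.smul_mul, hH, smul_smul, smul_smul]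
      have : (1 + t ^ 2)⁻¹ * (1 + t ^ 2)⁻¹ * (1 + t ^ 2) ^ 2 = 1 := by field_simp
      rw [this, one_smul]
    have h0 := GG_orth S c hc _ hU
    have h1 := GG_smul S c (fun _ => (1 + t ^ 2)) ((1 + t ^ 2)⁻¹ • (H * Rt))
    rw [h0, mul_zero] at h1
    rw [← h1]
    congr 1
    ext k j
    simp only [Matrix.of_apply, Matrix.smul_apply, smul_eq_mul]
    field_simp
  let Mt : Matrix (Fin (m+1)) (Fin (m+1)) (Polynomial ℝ) := Matrix.of fun k j =>
    Polynomial.C (H k j) + Polynomial.C (2 * (H * B) k j) * Polynomial.X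
      + Polynomial.C (H k j - 2 * (H * E) k j) * Polynomial.X ^ 2
  have hG0 : GG S c Mt = 0 := by
    apply Polynomial.funext
    intro t
    have h1 := GG_map S c (Polynomial.aeval (R := ℝ) t) Mt
    rw [Polynomial.coe_aeval_eq_eval] at h1
    rw [h1, Polynomial.eval_zero, ← hrot t]
    congr 1
    ext k j
    simp only [Mt, Matrix.map_apply, Matrix.of_apply, mul_add, mul_sub, Matrix.mul_smul, Matrix.add_apply,
      Matrix.sub_apply, Matrix.smul_apply, smul_eq_mul, Matrix.mul_one]
    simp
    ring
  have h2 := GG_map S c (Polynomial.aeval (R := ℝ) Complex.I) Mt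
  rw [hG0, map_zero] at h2
  let ζ : Fin (m+1) → ℂ := fun k => 2 * ((H k 0 : ℂ) - Complex.I * ((H *ᵥ w) k : ℂ))
  have hMI : Mt.map (Polynomial.aeval (R := ℝ) Complex.I) = Matrix.of fun k j => ζ k *
      (Matrix.of fun _ j : Fin (m+1) => ((e j : ℂ) + Complex.I * (w j : ℂ))) k j := by
    ext k j
    have hHe : (H *ᵥ e) k = H k 0 := by simp [he]
    have hHB : (H * B) k j = H k 0 * w j - (H *ᵥ w) k * e j := by
      rw [hB, mul_sub, Matrix.mul_vecMulVec, Matrix.mul_vecMulVec, Matrix.sub_apply, 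
        Matrix.vecMulVec_apply, Matrix.vecMulVec_apply, hHe]
    have hHE : (H * E) k j = H k 0 * e j + (H *ᵥ w) k * w j := by
      rw [hE, mul_add, Matrix.mul_vecMulVec, Matrix.mul_vecMulVec, Matrix.add_apply, 
        Matrix.vecMulVec_apply, Matrix.vecMulVec_apply, hHe]
    simp only [Mt, Matrix.map_apply, Matrix.of_apply, hHB, hHE, ζ]
    simp only [map_add, map_mul, Polynomial.aeval_C, Polynomial.aeval_X, map_pow, Complex.I_sq, 
      Complex.coe_algebraMap]
    push_cast
    linear_combination (2 * (w j : ℂ) * ((H *ᵥ w) k : ℂ)) * Complex.I_sq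
  rw [hMI, GG_smul] at h2
  refine (mul_eq_zero.mp h2.symm).resolve_left ?_
  refine Finset.prod_ne_zero_iff.mpr ?_
  intro k _ h0
  apply hH0 k
  have := congrArg Complex.re h0
  simpa [ζ] using this

theorem indep {m : ℕ} (S : Finset (Fin (m+2) →₀ ℕ)) (hS1 : ∀ α ∈ S, ∑ i, α i = m + 2)
    (hS2 : ∀ α ∈ S, α 0 ≤ 1) (c : (Fin (m+2) →₀ ℕ) → ℝ)
    (hc : ∀ A : symTraceless (m+2), ∑ α ∈ S, c α * coeff α (PA A.1) = 0) :
    ∀ α ∈ S, c α = 0 := by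
  set mo : (Fin (m+2) →₀ ℕ) → (Fin (m+2) → ℝ) → ℝ := fun α y => ∏ j : Fin (m+1), y j.succ ^ α j.succ with hmo
  have hsucc : ∀ α ∈ S, α 0 + ∑ j : Fin (m+1), α j.succ = m + 2 := by
    intro α hα
    exact (Fin.sum_univ_succ (fun i => α i)).symm.trans (hS1 α hα)
  set T0 : (Fin (m+2) → ℝ) → ℝ := fun y => ∑ α ∈ S, if α 0 = 0 then c α * α.multinomial * mo α y else 0 with hT0
  set T1 : (Fin (m+2) → ℝ) → ℝ := fun y => ∑ α ∈ S, if α 0 = 0 then 0 else c α * α.multinomial * mo α y with hT1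
  have hunit : ∀ w : Fin (m+2) → ℝ, w 0 = 0 → w ⬝ᵥ w = 1 → T0 w = 0 ∧ T1 w = 0 := by
    intro w hw0 hw
    have h := GG_isotropic S c hc w hw0 hw
    unfold GG at h
    have key : Complex.I ^ (m+2) * (Complex.I * (T0 w : ℂ) + (T1 w : ℂ)) = 0 := by
      rw [← mul_zero Complex.I, ← h, hT0, hT1]
      push_cast
      rw [Finset.mul_sum, ← Finset.sum_add_distrib, Finset.mul_sum, Finset.mul_sum]
      refine Finset.sum_congr rfl fun α hα => ?_
      have hs := hsucc α hα
      have h1 := hS2 α hα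
      have hlin : ∀ k, linF (Matrix.of fun _ j : Fin (m+2) =>
          (((Pi.single 0 1 : Fin (m+2) → ℝ) j : ℂ) + Complex.I * (w j : ℂ))) k
          = ∑ j, (((Pi.single 0 1 : Fin (m+2) → ℝ) j : ℂ) + Complex.I * (w j : ℂ)) • X j := by
        intro k
        simp only [linF, Matrix.of_apply, smul_eq_C_mul]
      have hsum : (α.sum fun _ k => k) = m + 2 := by
        rw [Finsupp.sum_fintype _ _ (fun _ => rfl)]; exact hS1 α hα
      simp only [hlin]
      rw [Finset.prod_const, Finset.card_univ, Fintype.card_fin, 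
        coeff_linearCombination_X_pow_of_fintype, if_pos hsum, Finsupp.prod_fintype]
      · rw [Fin.prod_univ_succ]
        have hz : ∏ i : Fin (m+1), ((((Pi.single 0 1 : Fin (m+2) → ℝ) i.succ : ℝ) : ℂ) + Complex.I * (w i.succ : ℂ)) ^ α i.succ
           = Complex.I ^ (∑ j : Fin (m+1), α j.succ) * (mo α w : ℂ) := by
          rw [← Finset.prod_pow_eq_pow_sum, hmo]
          push_cast
          rw [← Finset.prod_mul_distrib]
          refine Finset.prod_congr rfl fun i _ => ?_
          rw [Pi.single_eq_of_ne (Fin.succ_ne_zero i)]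
          simp [mul_pow]
        rw [hz, Pi.single_eq_same, hw0]
        rcases Nat.le_one_iff_eq_zero_or_eq_one.mp h1 with h0 | h0
        · rw [h0, zero_add] at hs
          simp [h0, hs]
          ring
        · have hs' : ∑ j : Fin (m+1), α j.succ = m + 1 := by omega
          simp [h0, hs']
          ring
      · intro i; simp
    have hI : Complex.I ^ (m+2) ≠ 0 := pow_ne_zero _ Complex.I_ne_zero
    have h2 := (mul_eq_zero.mp key).resolve_left hI
    constructor
    · simpa using congrArg Complex.im h2
    · simpa using congrArg Complex.re h2
  have hall : ∀ y, T0 y = 0 ∧ T1 y = 0 := by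
    intro y
    by_cases hy : ∀ j : Fin (m+1), y j.succ = 0
    · have : ∀ α ∈ S, mo α y = 0 := by
        intro α hα
        have hs := hsucc α hα
        have h1 := hS2 α hα
        obtain ⟨j, hj⟩ : ∃ j : Fin (m+1), α j.succ ≠ 0 := by
          by_contra! hcon
          simp [hcon] at hs
          omega
        exact Finset.prod_eq_zero (Finset.mem_univ j) (by rw [hy j, zero_pow hj])
      constructor
      · exact Finset.sum_eq_zero fun α hα => by simp [this α hα]
      · exact Finset.sum_eq_zero fun α hα => by simp [this α hα]
    · push Not at hy
      obtain ⟨j0, hj0⟩ := hy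
      set q := ∑ j : Fin (m+1), y j.succ ^ 2 with hq
      have hqpos : 0 < q := Finset.sum_pos' (fun j _ => sq_nonneg _) ⟨j0, Finset.mem_univ _, by positivity⟩
      set s := Real.sqrt q with hs
      have hs0 : s ≠ 0 := (Real.sqrt_pos.mpr hqpos).ne'
      have hss : s ^ 2 = q := Real.sq_sqrt hqpos.le
      set w : Fin (m+2) → ℝ := Fin.cons 0 (fun j => s⁻¹ * y j.succ) with hw
      have hw0 : w 0 = 0 := rfl
      have hww : w ⬝ᵥ w = 1 := by
        simp only [dotProduct, Fin.sum_univ_succ (n := m+1), hw, Fin.cons_zero, Fin.cons_succ]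
        have : ∀ j : Fin (m+1), s⁻¹ * y j.succ * (s⁻¹ * y j.succ) = (s ^ 2)⁻¹ * y j.succ ^ 2 := by
          intro j; field_simp
        simp only [this]
        rw [← Finset.mul_sum, ← hq, hss]
        field_simp
        simp
      have hmow : ∀ α, mo α w = s⁻¹ ^ (∑ j : Fin (m+1), α j.succ) * mo α y := by
        intro α
        simp only [hmo, hw, Fin.cons_succ]
        rw [← Finset.prod_pow_eq_pow_sum, ← Finset.prod_mul_distrib]
        simp only [mul_pow]
      obtain ⟨h0, h1⟩ := hunit w hw0 hww
      have e0 : T0 w = s⁻¹ ^ (m+2) * T0 y := by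
        simp only [hT0]
        rw [Finset.mul_sum]
        refine Finset.sum_congr rfl fun α hα => ?_
        have hs := hsucc α hα
        split_ifs with h
        · rw [hmow, show ∑ j : Fin (m+1), α j.succ = m + 2 by omega]; ring
        · simp
      have e1 : T1 w = s⁻¹ ^ (m+1) * T1 y := by
        simp only [hT1]
        rw [Finset.mul_sum]
        refine Finset.sum_congr rfl fun α hα => ?_
        have hs := hsucc α hα
        have h1 := hS2 α hα
        split_ifs with h
        · simp
        · rw [hmow, show ∑ j : Fin (m+1), α j.succ = m + 1 by omega]; ring
      rw [e0] at h0
      rw [e1] at h1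
      have hi : s⁻¹ ≠ 0 := inv_ne_zero hs0
      exact ⟨(mul_eq_zero.mp h0).resolve_left (pow_ne_zero _ hi),
        (mul_eq_zero.mp h1).resolve_left (pow_ne_zero _ hi)⟩
  have hQ : (∑ α ∈ S, monomial α (c α * α.multinomial) : MvPolynomial (Fin (m+2)) ℝ) = 0 := by
    apply MvPolynomial.funext
    intro y
    obtain ⟨h0, h1⟩ := hall y
    have : T0 y + y 0 * T1 y = 0 := by rw [h0, h1]; ring
    rw [map_sum, map_zero, ← this]
    simp only [hT0, hT1]
    rw [Finset.mul_sum, ← Finset.sum_add_distrib]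
    refine Finset.sum_congr rfl fun α hα => ?_
    rw [eval_monomial, Finsupp.prod_fintype _ _ (by simp), Fin.prod_univ_succ]
    have h1 := hS2 α hα
    rcases Nat.le_one_iff_eq_zero_or_eq_one.mp h1 with h0 | h0
    · simp [h0, hmo]
    · simp [h0, hmo]; ring
  intro α hα
  classical
  have := congrArg (coeff α) hQ
  rw [coeff_sum] at this
  simp only [coeff_monomial] at this
  rw [Finset.sum_ite_eq' S α, if_pos hα, coeff_zero] at this
  refine (mul_eq_zero.mp this).resolve_right ?_
  have : 0 < α.multinomial := Nat.multinomial_pos _ _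
  exact_mod_cast this.ne'

theorem finsupp_degree_eq {n : ℕ} (α : Fin n →₀ ℕ) : α.degree = ∑ i, α i := by
  rw [Finsupp.degree_eq_sum]

/-- There is a `D`-dimensional `SO_n`-stable subspace of polynomial functions on the space
`N` of trace-zero real symmetric matrices, where
`D = C(2n-1, n-1) - C(2n-3, n-1)`, all of whose elements are homogeneous of degree
`n(n-1)/2` and vanish on the set `F` of degenerate matrices. -/
theorem exists_stable_subspace_of_sph_dim (n : ℕ) (hn : 2 ≤ n) :
    ∃ W : Submodule ℝ (↥(symTraceless n) → ℝ),
      Module.finrank ℝ ↥W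
          = Nat.choose (2 * n - 1) (n - 1) - Nat.choose (2 * n - 3) (n - 1) ∧
      (∀ f ∈ W, ∃ p : MvPolynomial (Fin n × Fin n) ℝ,
        p.IsHomogeneous (n * (n - 1) / 2) ∧ ∀ A : ↥(symTraceless n), f A = evalMat p A.1) ∧
      (∀ f ∈ W, ∀ A : ↥(symTraceless n), Degen A → f A = 0) ∧
      (∀ (g : Matrix (Fin n) (Fin n) ℝ) (hg : gᵀ * g = 1), g.det = 1 →
        ∀ f ∈ W, (fun A => f (soConj g hg A)) ∈ W) := by
  classical
  obtain ⟨m, rfl⟩ : ∃ m, n = m + 2 := ⟨n - 2, by omega⟩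
  set S := ((Finset.univ : Finset (Fin (m+2))).finsuppAntidiag (m+2)).filter (fun α => α 0 ≤ 1) with hS
  have hS1 : ∀ α ∈ S, ∑ i, α i = m + 2 := by
    intro α hα
    simp only [hS, Finset.mem_filter, Finset.mem_finsuppAntidiag] at hα
    exact hα.1.1
  have hS2 : ∀ α ∈ S, α 0 ≤ 1 := by
    intro α hα
    simp only [hS, Finset.mem_filter] at hα
    exact hα.2
  let F : (Fin (m+2) →₀ ℕ) → (symTraceless (m+2) → ℝ) := fun α A => coeff α (PA A.1)
  let W : Submodule ℝ (symTraceless (m+2) → ℝ) := Submodule.span ℝ (Set.range fun α : S => F α.1)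
  have hred : ∀ α, F α ∈ W := by
    intro α
    by_cases hd : α.degree = m + 2
    · refine reduce F ?_ (m+2) W ?_ (α 0) α rfl hd
      · intro β
        funext A
        have := lap_PA A β
        simpa [F] using this
      · intro β hβ hβ0
        refine Submodule.subset_span ⟨⟨β, ?_⟩, rfl⟩
        simp only [hS, Finset.mem_filter, Finset.mem_finsuppAntidiag]
        exact ⟨⟨by rw [← finsupp_degree_eq]; exact hβ, Finset.subset_univ _⟩, hβ0⟩
    · have : F α = 0 := by
        funext A
        exact (PA_isHomogeneous A.1).coeff_eq_zero hd
      rw [this]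
      exact W.zero_mem
  have hdual : ∀ ℓ : MvPolynomial (Fin (m+2)) ℝ →ₗ[ℝ] ℝ, (fun A : symTraceless (m+2) => ℓ (PA A.1)) ∈ W := by
    intro ℓ
    have : (fun A : symTraceless (m+2) => ℓ (PA A.1)) =
        ∑ α ∈ (Finset.univ : Finset (Fin (m+2))).finsuppAntidiag (m+2), ℓ (monomial α 1) • F α := by
      funext A
      have hsub : (PA A.1).support ⊆ (Finset.univ : Finset (Fin (m+2))).finsuppAntidiag (m+2) := by
        intro α hα
        rw [Finset.mem_finsuppAntidiag, ← finsupp_degree_eq]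
        refine ⟨?_, Finset.subset_univ _⟩
        by_contra hne
        exact (mem_support_iff.mp hα) ((PA_isHomogeneous A.1).coeff_eq_zero hne)
      have h1 : PA A.1 = ∑ α ∈ (Finset.univ : Finset (Fin (m+2))).finsuppAntidiag (m+2),
          coeff α (PA A.1) • monomial α (1 : ℝ) := by
        conv_lhs => rw [(PA A.1).as_sum]
        rw [Finset.sum_subset hsub]
        · refine Finset.sum_congr rfl fun α _ => ?_
          rw [smul_monomial, smul_eq_mul, mul_one]
        · intro α _ hα
          rw [notMem_support_iff.mp hα, monomial_zero]
      conv_lhs => rw [h1]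
      rw [map_sum, Finset.sum_apply]
      refine Finset.sum_congr rfl fun α _ => ?_
      rw [map_smul, Pi.smul_apply, smul_eq_mul, smul_eq_mul, mul_comm]
    rw [this]
    exact W.sum_mem fun α _ => W.smul_mem _ (hred α)
  refine ⟨W, ?_, ?_, ?_, ?_⟩
  · have hli : LinearIndependent ℝ (fun α : S => F α.1) := by
      rw [Fintype.linearIndependent_iff]
      intro c hc
      let c' : (Fin (m+2) →₀ ℕ) → ℝ := fun α => if h : α ∈ S then c ⟨α, h⟩ else 0
      have h := indep S hS1 hS2 c' (by
        intro A
        have := congrFun hc A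
        rw [Finset.sum_apply] at this
        rw [← Finset.sum_coe_sort, ← (this.trans (rfl : _ = (0 : ℝ)))]
        refine Finset.sum_congr rfl fun α _ => ?_
        simp [c', F])
      intro α
      have := h α.1 α.2
      simpa [c'] using this
    rw [finrank_span_eq_card hli, Fintype.card_coe]
    exact card_S m
  · intro f hf
    induction hf using Submodule.span_induction with
    | mem x hx =>
      obtain ⟨α, rfl⟩ := hx
      exact ⟨_, CH_PA (m+2) α.1, fun A => coeff_PA_poly _ _⟩
    | zero => exact ⟨0, isHomogeneous_zero _ _ _, fun A => by simp [evalMat]⟩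
    | add x y _ _ hx hy =>
      obtain ⟨p, hp, hp'⟩ := hx
      obtain ⟨q, hq, hq'⟩ := hy
      exact ⟨p + q, hp.add hq, fun A => by simp [evalMat, hp', hq']⟩
    | smul a x _ hx =>
      obtain ⟨p, hp, hp'⟩ := hx
      exact ⟨C a * p, hp.C_mul a, fun A => by simp [evalMat, hp']⟩
  · intro f hf A hA
    induction hf using Submodule.span_induction with
    | mem x hx =>
      obtain ⟨α, rfl⟩ := hx
      simp [F, PA_degen A hA]
    | zero => rfl
    | add x y _ _ hx hy => simp [hx, hy]
    | smul a x _ hx => simp [hx]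
  · intro g hg hd f hf
    induction hf using Submodule.span_induction with
    | mem x hx =>
      obtain ⟨α, rfl⟩ := hx
      have := hdual ((lcoeff ℝ α.1).comp (bind₁ (linF g)).toLinearMap)
      have he : (fun A => F α.1 (soConj g hg A)) = (fun A : symTraceless (m+2) =>
          ((lcoeff ℝ α.1).comp (bind₁ (linF g)).toLinearMap) (PA A.1)) := by
        funext A
        simp only [F, soConj, PA_conj g A.1 hg hd]
        rfl
      rw [← he] at this
      exact this
    | zero => exact W.zero_mem
    | add x y _ _ hx hy => exact W.add_mem hx hy
    | smul a x _ hx => exact W.smul_mem a hx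
end

section
/- In the polynomial ring R[a,b,d,e,f] the following identity holds: −4p³ − 27q² = 27(aef − bef − de² + df²)² + (2a³ + 3a²b − 3ab² − ad² + 2ae² − af² − 2b³ + bd² + be² − 2bf²)² + (4a²d + 10abd + 3aef + 4b²d + 3bef − 2d³ + de² + df²)² + 4(a²e + abe + 3adf − 2b²e + 3bdf − 2d²e + e³ + ef²)² + 4(2a²f − abf − 3ade − b²f − 3bde + 2d²f − e²f − f³)², where p = −a² − ab − b² − d² − e² − f² and q = a²b + ab² − ad² + af² − bd² + be² − 2def. Consequently, the discriminant of the trace-zero symmetric 3×3 matrix [[a,d,e],[d,b,f],[e,f,−a−b]], which equals −4p³ − 27q², is a sum of five squares of polynomials. -/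
open MvPolynomial BigOperators

noncomputable def a : MvPolynomial (Fin 5) ℝ := X 0
noncomputable def b : MvPolynomial (Fin 5) ℝ := X 1
noncomputable def d : MvPolynomial (Fin 5) ℝ := X 2
noncomputable def e : MvPolynomial (Fin 5) ℝ := X 3
noncomputable def f : MvPolynomial (Fin 5) ℝ := X 4

/-- `p = -a² - ab - b² - d² - e² - f²`, so that the discriminant of the trace-zero symmetric
matrix `[[a,d,e],[d,b,f],[e,f,-a-b]]` is `-4p³ - 27q²`. -/
noncomputable def pPoly : MvPolynomial (Fin 5) ℝ := -a^2 - a*b - b^2 - d^2 - e^2 - f^2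

/-- `q = a²b + ab² - ad² + af² - bd² + be² - 2def`. -/
noncomputable def qPoly : MvPolynomial (Fin 5) ℝ :=
  a^2*b + a*b^2 - a*d^2 + a*f^2 - b*d^2 + b*e^2 - 2*d*e*f

theorem aux_identity {R : Type*} [CommRing R] (a b d e f : R) :
    -4 * (-a^2 - a*b - b^2 - d^2 - e^2 - f^2)^3 -
      27 * (a^2*b + a*b^2 - a*d^2 + a*f^2 - b*d^2 + b*e^2 - 2*d*e*f)^2 =
      27*(a*e*f - b*e*f - d*e^2 + d*f^2)^2
      + (2*a^3 + 3*a^2*b - 3*a*b^2 - a*d^2 + 2*a*e^2 - a*f^2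
          - 2*b^3 + b*d^2 + b*e^2 - 2*b*f^2)^2
      + (4*a^2*d + 10*a*b*d + 3*a*e*f + 4*b^2*d + 3*b*e*f - 2*d^3 + d*e^2 + d*f^2)^2
      + 4*(a^2*e + a*b*e + 3*a*d*f - 2*b^2*e + 3*b*d*f - 2*d^2*e + e^3 + e*f^2)^2
      + 4*(2*a^2*f - a*b*f - 3*a*d*e - b^2*f - 3*b*d*e + 2*d^2*f - e^2*f - f^3)^2 := by
  ring

/-- The discriminant `-4p³ - 27q²` of `3×3` trace-zero real symmetric matrices is the given
explicit sum of five squares of polynomials. -/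
theorem discriminant_three_eq_sum_five_squares :
    (-4 * pPoly^3 - 27 * qPoly^2 =
      27*(a*e*f - b*e*f - d*e^2 + d*f^2)^2
      + (2*a^3 + 3*a^2*b - 3*a*b^2 - a*d^2 + 2*a*e^2 - a*f^2
          - 2*b^3 + b*d^2 + b*e^2 - 2*b*f^2)^2
      + (4*a^2*d + 10*a*b*d + 3*a*e*f + 4*b^2*d + 3*b*e*f - 2*d^3 + d*e^2 + d*f^2)^2
      + 4*(a^2*e + a*b*e + 3*a*d*f - 2*b^2*e + 3*b*d*f - 2*d^2*e + e^3 + e*f^2)^2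
      + 4*(2*a^2*f - a*b*f - 3*a*d*e - b^2*f - 3*b*d*e + 2*d^2*f - e^2*f - f^3)^2) ∧
    ∃ g : Fin 5 → MvPolynomial (Fin 5) ℝ,
      -4 * pPoly^3 - 27 * qPoly^2 = ∑ i, (g i)^2 := by
  have h := aux_identity a b d e f
  refine ⟨h, ?_⟩
  have h27 : (C (Real.sqrt 27) : MvPolynomial (Fin 5) ℝ)^2 = 27 := by
    rw [← C_pow, Real.sq_sqrt (by norm_num)]
    exact map_ofNat C 27
  refine ⟨![C (Real.sqrt 27) * (a*e*f - b*e*f - d*e^2 + d*f^2),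
    2*a^3 + 3*a^2*b - 3*a*b^2 - a*d^2 + 2*a*e^2 - a*f^2
          - 2*b^3 + b*d^2 + b*e^2 - 2*b*f^2,
    4*a^2*d + 10*a*b*d + 3*a*e*f + 4*b^2*d + 3*b*e*f - 2*d^3 + d*e^2 + d*f^2,
    2*(a^2*e + a*b*e + 3*a*d*f - 2*b^2*e + 3*b*d*f - 2*d^2*e + e^3 + e*f^2),
    2*(2*a^2*f - a*b*f - 3*a*d*e - b^2*f - 3*b*d*e + 2*d^2*f - e^2*f - f^3)], ?_⟩
  have h4 : (2 : MvPolynomial (Fin 5) ℝ)^2 = 4 := by norm_num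
  rw [Fin.sum_univ_five]
  change _ = (C (Real.sqrt 27) * _)^2 + (_)^2 + (_)^2 + (2 * _)^2 + (2 * _)^2
  rw [mul_pow (C (Real.sqrt 27)), mul_pow 2, mul_pow 2, h27, h4]
  exact h
end

section
/- There do not exist polynomials f_1, f_2, f_3, f_4 ∈ R[a,b,d,e,f] such that −4p³ − 27q² = f_1² + f_2² + f_3² + f_4², where p = −a² − ab − b² − d² − e² − f² and q = a²b + ab² − ad² + af² − bd² + be² − 2def. That is, the discriminant of 3×3 trace-zero real symmetric matrices cannot be written as a sum of four (or fewer) squares of real polynomials, so the minimal number of squares μ(3) equals 5. -/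
open MvPolynomial BigOperators

open Polynomial in
lemma uni_aux (P : Fin 4 → ℝ[X]) (K : ℝ)
    (h : ∀ t : ℝ, ∑ i, (P i).eval t ^ 2 = K * t ^ 6) (i : Fin 4) :
    ∃ c : ℝ, P i = Polynomial.C c * Polynomial.X ^ 3 := by
  have step : ∀ (n : ℕ) (Q : Fin 4 → ℝ[X]),
      (∀ t : ℝ, ∑ i, (Q i).eval t ^ 2 = K * t ^ (2 * n)) →
      ∃ c : Fin 4 → ℝ, ∀ i, Q i = Polynomial.C (c i) * Polynomial.X ^ n := by
    intro n
    induction n with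
    | zero =>
      intro Q hQ
      refine ⟨fun i => (Q i).coeff 0, fun i => ?_⟩
      simp only [pow_zero, mul_one]
      apply Polynomial.eq_C_of_degree_le_zero
      rw [← Polynomial.isBoundedUnder_abs_atTop_iff]
      refine Filter.isBoundedUnder_of ⟨K + 1, fun t => ?_⟩
      have h1 := hQ t
      simp only [mul_zero, pow_zero, mul_one] at h1
      have h2 : (Q i).eval t ^ 2 ≤ K := by
        rw [← h1]
        exact Finset.single_le_sum (f := fun i => (Q i).eval t ^ 2)
          (fun j _ => sq_nonneg _) (Finset.mem_univ i)
      have := sq_abs ((Q i).eval t)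
      nlinarith [sq_nonneg (|(Q i).eval t| - 1), abs_nonneg ((Q i).eval t)]
    | succ n ih =>
      intro Q hQ
      have h0 : ∀ i, (Q i).eval 0 = 0 := by
        intro i
        have h1 := hQ 0
        rw [zero_pow (by omega), mul_zero,
          Finset.sum_eq_zero_iff_of_nonneg (fun j _ => sq_nonneg _)] at h1
        exact pow_eq_zero_iff (two_ne_zero) |>.1 (h1 i (Finset.mem_univ i))
      have h1 : ∀ i, ∃ R : ℝ[X], Q i = Polynomial.X * R := by
        intro i
        exact Polynomial.X_dvd_iff.2 (by rw [Polynomial.coeff_zero_eq_eval_zero]; exact h0 i)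
      choose R hR using h1
      have key : (∑ i, R i ^ 2) = Polynomial.C K * Polynomial.X ^ (2 * n) := by
        have : Polynomial.X ^ 2 * (∑ i, R i ^ 2)
            = Polynomial.X ^ 2 * (Polynomial.C K * Polynomial.X ^ (2 * n)) := by
          apply Polynomial.funext
          intro t
          have h2 := hQ t
          simp only [hR, Polynomial.eval_mul, Polynomial.eval_X, mul_pow] at h2
          simp only [Polynomial.eval_mul, Polynomial.eval_X, Polynomial.eval_pow,
            Polynomial.eval_C, Polynomial.eval_finsetSum, Finset.mul_sum, h2]
          ring
        exact mul_left_cancel₀ (pow_ne_zero 2 Polynomial.X_ne_zero) this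
      obtain ⟨c, hc⟩ := ih R (by
        intro t
        have := congrArg (Polynomial.eval t) key
        simpa [Polynomial.eval_finsetSum] using this)
      refine ⟨c, fun i => ?_⟩
      rw [hR, hc]; ring
  obtain ⟨c, hc⟩ := step 3 P h
  exact ⟨c i, hc i⟩

lemma hom_aux (F : Fin 4 → MvPolynomial (Fin 5) ℝ) (D : MvPolynomial (Fin 5) ℝ)
    (hD : D.IsHomogeneous 6) (h : ∑ i, F i ^ 2 = D) (i : Fin 4) :
    (F i).IsHomogeneous 3 := by
  have hev : ∀ (G : MvPolynomial (Fin 5) ℝ) (n : ℕ), G.IsHomogeneous n →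
      ∀ (x : Fin 5 → ℝ) (t : ℝ), eval (fun j => t * x j) G = eval x G * t ^ n := by
    intro G n hG x t
    rw [eval_eq, eval_eq, Finset.sum_mul]
    apply Finset.sum_congr rfl
    intro m hm
    have : ∑ j, m j = n := by
      have := hG.degree_eq_sum_deg_support hm
      rw [this]
      symm
      apply Finset.sum_subset (Finset.subset_univ _)
      intro j _ hj
      simpa using hj
    rw [← this, ← Finset.prod_pow_eq_pow_sum]
    have h2 : ∏ j ∈ m.support, t ^ m j = ∏ j, t ^ m j := by
      apply Finset.prod_subset (Finset.subset_univ _)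
      intro j _ hj
      simp only [Finsupp.mem_support_iff, not_not] at hj
      simp [hj]
    rw [← h2, mul_assoc, ← Finset.prod_mul_distrib]
    congr 1
    apply Finset.prod_congr rfl
    intro j _
    ring
  have hz : ∀ n, n ≠ 3 → homogeneousComponent n (F i) = 0 := by
    intro n hn
    apply MvPolynomial.funext
    intro x
    let P : Fin 4 → Polynomial ℝ := fun k =>
      ∑ m ∈ Finset.range ((F k).totalDegree + 1),
        Polynomial.C (eval x (homogeneousComponent m (F k))) * Polynomial.X ^ m
    have hP : ∀ k t, (P k).eval t = eval (fun j => t * x j) (F k) := by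
      intro k t
      conv_rhs => rw [← sum_homogeneousComponent (F k)]
      simp only [P, Polynomial.eval_finsetSum, map_sum, Polynomial.eval_mul, Polynomial.eval_C,
        Polynomial.eval_pow, Polynomial.eval_X]
      apply Finset.sum_congr rfl
      intro m _
      rw [hev _ m (homogeneousComponent_isHomogeneous m _)]
    obtain ⟨c, hc⟩ := uni_aux P (eval x D) (by
      intro t
      rw [← hev D 6 hD, ← h]
      simp [hP]) i
    have h3 := congrArg (fun q => Polynomial.coeff q n) hc
    simp only [P, Polynomial.finsetSum_coeff, Polynomial.coeff_C_mul, Polynomial.coeff_X_pow,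
      if_neg hn, mul_ite, mul_one, mul_zero, Finset.sum_ite_eq, Finset.mem_range] at h3
    split_ifs at h3 with h4
    · simpa using h3
    · rw [homogeneousComponent_eq_zero _ _ (by omega)]
  rw [← sum_homogeneousComponent (F i)]
  apply IsHomogeneous.sum
  intro m _
  by_cases hm : m = 3
  · subst hm; exact homogeneousComponent_isHomogeneous 3 _
  · rw [hz m hm]; exact isHomogeneous_zero _ _ _

lemma disc_hom : (-4 * pPoly^3 - 27 * qPoly^2).IsHomogeneous 6 := by
  have ha : a.IsHomogeneous 1 := isHomogeneous_X _ _
  have hb : b.IsHomogeneous 1 := isHomogeneous_X _ _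
  have hd : d.IsHomogeneous 1 := isHomogeneous_X _ _
  have he : e.IsHomogeneous 1 := isHomogeneous_X _ _
  have hf : f.IsHomogeneous 1 := isHomogeneous_X _ _
  have hp : pPoly.IsHomogeneous 2 :=
    ((((((ha.pow 2).neg).sub (ha.mul hb)).sub (hb.pow 2)).sub (hd.pow 2)).sub (he.pow 2)).sub
      (hf.pow 2)
  have h2 : (2 : MvPolynomial (Fin 5) ℝ).IsHomogeneous 0 := isHomogeneous_C _ (2:ℝ)
  have h4 : (-4 : MvPolynomial (Fin 5) ℝ).IsHomogeneous 0 := (isHomogeneous_C _ (4:ℝ)).neg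
  have h27 : (27 : MvPolynomial (Fin 5) ℝ).IsHomogeneous 0 := isHomogeneous_C _ (27:ℝ)
  have hq : qPoly.IsHomogeneous 3 :=
    (((((((ha.pow 2).mul hb).add (ha.mul (hb.pow 2))).sub (ha.mul (hd.pow 2))).add
      (ha.mul (hf.pow 2))).sub (hb.mul (hd.pow 2))).add (hb.mul (he.pow 2))).sub
      (((h2.mul hd).mul he).mul hf)
  exact (h4.mul (hp.pow 3)).sub (h27.mul (hq.pow 2))

/-- the complex slice -/
noncomputable def slc (x : Fin 4 → ℂ) : Fin 5 → ℂ :=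
  ![(x 0 + x 3) / 4 - x 1 / 2, -x 1 / 2 - (x 0 + x 3) / 4, -Complex.I * (x 0 - x 3) / 4,
    -x 2 / 2, -Complex.I * x 2 / 2]

lemma lin_aux (p : MvPolynomial (Fin 5) ℝ) (hp : p ∈ homogeneousSubmodule (Fin 5) ℝ 1) :
    ∃ c : Fin 4 → ℂ, ∀ x, aeval (slc x) p = ∑ i, c i * x i := by
  rw [homogeneousSubmodule_one_eq_span_X] at hp
  induction hp using Submodule.span_induction with
  | mem p hp =>
    obtain ⟨j, rfl⟩ := hp
    fin_cases j
    · exact ⟨![1/4, -1/2, 0, 1/4], fun x => by simp [slc, Fin.sum_univ_four]; ring⟩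
    · exact ⟨![-1/4, -1/2, 0, -1/4], fun x => by simp [slc, Fin.sum_univ_four]; ring⟩
    · exact ⟨![-Complex.I/4, 0, 0, Complex.I/4], fun x => by simp [slc, Fin.sum_univ_four]; ring⟩
    · exact ⟨![0, 0, -1/2, 0], fun x => by simp [slc, Fin.sum_univ_four]; ring⟩
    · exact ⟨![0, 0, -Complex.I/2, 0], fun x => by simp [slc, Fin.sum_univ_four]; ring⟩
  | zero => exact ⟨0, fun x => by simp⟩
  | add p q _ _ h1 h2 =>
    obtain ⟨c, hc⟩ := h1
    obtain ⟨c', hc'⟩ := h2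
    exact ⟨c + c', fun x => by simp [hc, hc', add_mul, Finset.sum_add_distrib]⟩
  | smul r p _ h1 =>
    obtain ⟨c, hc⟩ := h1
    refine ⟨fun i => r * c i, fun x => ?_⟩
    rw [map_smul, hc, Complex.real_smul, Finset.mul_sum]
    exact Finset.sum_congr rfl fun i _ => by ring

lemma quad_aux (p : MvPolynomial (Fin 5) ℝ)
    (hp : p ∈ homogeneousSubmodule (Fin 5) ℝ 1 * homogeneousSubmodule (Fin 5) ℝ 1) :
    ∃ c : Fin 4 → Fin 4 → ℂ, ∀ x, aeval (slc x) p = ∑ i, ∑ j, c i j * x i * x j := by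
  induction hp using Submodule.mul_induction_on' with
  | mem_mul_mem p hp q hq =>
    obtain ⟨c, hc⟩ := lin_aux p hp
    obtain ⟨c', hc'⟩ := lin_aux q hq
    refine ⟨fun i j => c i * c' j, fun x => ?_⟩
    rw [map_mul, hc, hc', Finset.sum_mul_sum]
    exact Finset.sum_congr rfl fun i _ => Finset.sum_congr rfl fun j _ => by ring
  | add p _ q _ h1 h2 =>
    obtain ⟨c, hc⟩ := h1
    obtain ⟨c', hc'⟩ := h2
    exact ⟨c + c', fun x => by simp [hc, hc', add_mul, Finset.sum_add_distrib]⟩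

lemma cub_aux (p : MvPolynomial (Fin 5) ℝ) (hp : p.IsHomogeneous 3) :
    ∃ c : Fin 4 → Fin 4 → Fin 4 → ℂ, ∀ x,
      aeval (slc x) p = ∑ i, ∑ j, ∑ k, c i j k * x i * x j * x k := by
  replace hp : p ∈ homogeneousSubmodule (Fin 5) ℝ 1 * homogeneousSubmodule (Fin 5) ℝ 1
      * homogeneousSubmodule (Fin 5) ℝ 1 := by
    have : p ∈ homogeneousSubmodule (Fin 5) ℝ 3 := hp
    rw [← homogeneousSubmodule_one_pow] at this
    simpa only [pow_succ, pow_zero, one_mul] using this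
  induction hp using Submodule.mul_induction_on' with
  | mem_mul_mem p hp q hq =>
    obtain ⟨c, hc⟩ := quad_aux p hp
    obtain ⟨c', hc'⟩ := lin_aux q hq
    refine ⟨fun i j k => c i j * c' k, fun x => ?_⟩
    rw [map_mul, hc, hc', Finset.sum_mul]
    refine Finset.sum_congr rfl fun i _ => ?_
    rw [Finset.sum_mul_sum]
    exact Finset.sum_congr rfl fun j _ => Finset.sum_congr rfl fun k _ => by ring
  | add p _ q _ h1 h2 =>
    obtain ⟨c, hc⟩ := h1
    obtain ⟨c', hc'⟩ := h2
    exact ⟨c + c', fun x => by simp [hc, hc', add_mul, Finset.sum_add_distrib]⟩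

lemma poly_zero {n : ℕ} (c : Fin n → ℂ) (h : ∀ t : ℂ, ∑ k, c k * t ^ (k : ℕ) = 0) (k : Fin n) :
    c k = 0 := by
  have : (∑ k, Polynomial.C (c k) * Polynomial.X ^ (k : ℕ) : Polynomial ℂ) = 0 := by
    apply Polynomial.funext
    intro t
    simpa [Polynomial.eval_finsetSum] using h t
  have h2 := congrArg (fun q => Polynomial.coeff q (k : ℕ)) this
  simpa [Polynomial.finsetSum_coeff, Polynomial.coeff_X_pow, Fin.val_inj] using h2

lemma rank_aux (U V : Fin 5 → Fin 4 → ℂ)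
    (hd : ∀ i, ∑ k, U i k * V i k ≠ 0) (hl : ∀ i j, i < j → ∑ k, U i k * V j k = 0) : False := by
  let A : Matrix (Fin 5) (Fin 4) ℂ := Matrix.of U
  let B : Matrix (Fin 4) (Fin 5) ℂ := (Matrix.of V).transpose
  have hdet : (A * B).det ≠ 0 := by
    rw [Matrix.det_of_isLowerTriangular (A * B) (by
      intro i j hij
      exact hl i j hij)]
    exact Finset.prod_ne_zero_iff.2 fun i _ => hd i
  have h1 := Matrix.rank_of_isUnit (A * B) ((Matrix.isUnit_iff_isUnit_det _).2 hdet.isUnit)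
  have h2 := Matrix.rank_mul_le_left A B
  have h3 := Matrix.rank_le_width A
  simp at h1
  omega
lemma cub_aux20 (p : MvPolynomial (Fin 5) ℝ) (hp : p.IsHomogeneous 3) :
    ∃ k000 k001 k002 k003 k011 k012 k013 k022 k023 k033 k111 k112 k113 k122 k123 k133 k222 k223 k233 k333 : ℂ, ∀ x0 x1 x2 x3 : ℂ,
      aeval (slc ![x0, x1, x2, x3]) p =
        k000 * x0 * x0 * x0 + k001 * x0 * x0 * x1 + k002 * x0 * x0 * x2 + k003 * x0 * x0 * x3
        + k011 * x0 * x1 * x1 + k012 * x0 * x1 * x2 + k013 * x0 * x1 * x3 + k022 * x0 * x2 * x2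
        + k023 * x0 * x2 * x3 + k033 * x0 * x3 * x3 + k111 * x1 * x1 * x1 + k112 * x1 * x1 * x2
        + k113 * x1 * x1 * x3 + k122 * x1 * x2 * x2 + k123 * x1 * x2 * x3 + k133 * x1 * x3 * x3
        + k222 * x2 * x2 * x2 + k223 * x2 * x2 * x3 + k233 * x2 * x3 * x3 + k333 * x3 * x3 * x3 := by
  obtain ⟨c, hc⟩ := cub_aux p hp
  refine ⟨c 0 0 0,
    c 0 0 1 + c 0 1 0 + c 1 0 0,
    c 0 0 2 + c 0 2 0 + c 2 0 0,
    c 0 0 3 + c 0 3 0 + c 3 0 0,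
    c 0 1 1 + c 1 0 1 + c 1 1 0,
    c 0 1 2 + c 0 2 1 + c 1 0 2 + c 1 2 0 + c 2 0 1 + c 2 1 0,
    c 0 1 3 + c 0 3 1 + c 1 0 3 + c 1 3 0 + c 3 0 1 + c 3 1 0,
    c 0 2 2 + c 2 0 2 + c 2 2 0,
    c 0 2 3 + c 0 3 2 + c 2 0 3 + c 2 3 0 + c 3 0 2 + c 3 2 0,
    c 0 3 3 + c 3 0 3 + c 3 3 0,
    c 1 1 1,
    c 1 1 2 + c 1 2 1 + c 2 1 1,
    c 1 1 3 + c 1 3 1 + c 3 1 1,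
    c 1 2 2 + c 2 1 2 + c 2 2 1,
    c 1 2 3 + c 1 3 2 + c 2 1 3 + c 2 3 1 + c 3 1 2 + c 3 2 1,
    c 1 3 3 + c 3 1 3 + c 3 3 1,
    c 2 2 2,
    c 2 2 3 + c 2 3 2 + c 3 2 2,
    c 2 3 3 + c 3 2 3 + c 3 3 2,
    c 3 3 3, ?_⟩
  intro x0 x1 x2 x3
  rw [hc]
  simp only [Fin.sum_univ_four, Matrix.cons_val]
  ring

lemma vanish (p : MvPolynomial (Fin 5) ℝ)
    (h : ∀ v : Fin 3 → ℝ, eval ![2 * v 0 ^ 2 - v 1 ^ 2 - v 2 ^ 2, 2 * v 1 ^ 2 - v 0 ^ 2 - v 2 ^ 2,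
      3 * v 0 * v 1, 3 * v 0 * v 2, 3 * v 1 * v 2] p = 0) (v : Fin 3 → ℂ) :
    aeval ![2 * v 0 ^ 2 - v 1 ^ 2 - v 2 ^ 2, 2 * v 1 ^ 2 - v 0 ^ 2 - v 2 ^ 2,
      3 * v 0 * v 1, 3 * v 0 * v 2, 3 * v 1 * v 2] p = 0 := by
  let g : Fin 5 → MvPolynomial (Fin 3) ℝ :=
    ![2 * X 0 ^ 2 - X 1 ^ 2 - X 2 ^ 2, 2 * X 1 ^ 2 - X 0 ^ 2 - X 2 ^ 2,
      3 * X 0 * X 1, 3 * X 0 * X 2, 3 * X 1 * X 2]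
  have hg : aeval g p = 0 := by
    apply MvPolynomial.funext
    intro w
    rw [map_zero, ← h w, ← coe_aeval_eq_eval, ← coe_aeval_eq_eval, RingHom.coe_coe,
      RingHom.coe_coe, ← AlgHom.comp_apply, comp_aeval]
    congr 2
    funext j
    fin_cases j <;> simp [g]
  have h2 := congrArg (aeval v) hg
  rw [map_zero, ← AlgHom.comp_apply, comp_aeval] at h2
  rw [← h2]
  congr 2
  funext j
  fin_cases j <;> simp [g]

lemma shape (p : MvPolynomial (Fin 5) ℝ) (hp : p.IsHomogeneous 3)
    (h : ∀ v : Fin 3 → ℝ, eval ![2 * v 0 ^ 2 - v 1 ^ 2 - v 2 ^ 2, 2 * v 1 ^ 2 - v 0 ^ 2 - v 2 ^ 2,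
      3 * v 0 * v 1, 3 * v 0 * v 2, 3 * v 1 * v 2] p = 0) :
    ∃ u : Fin 7 → ℂ, ∀ x y z : ℂ, aeval (slc ![1, x, y, z]) p =
      u 0 * y + u 1 * (z - 9 * x ^ 2) + u 2 * (x * y) + u 3 * y ^ 2 + u 4 * (y * z)
      + u 5 * (z ^ 2 - 9 * z * x ^ 2 + 6 * x * y ^ 2) + u 6 * (2 * y ^ 3 - 3 * x * y * z) := by
  obtain ⟨k000, k001, k002, k003, k011, k012, k013, k022, k023, k033, k111, k112, k113, k122, k123, k133, k222, k223, k233, k333, hk⟩ := cub_aux20 p hp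
  have hI := Complex.I_sq
  have s1 : ∀ t : ℂ, aeval (slc ![3 * t ^ 2, t, 0, 3]) p = 0 := by
    intro t
    refine Eq.trans ?_ (vanish p h ![(t - 1) / 2, -Complex.I * (t + 1) / 2, 0])
    congr 2
    funext j
    fin_cases j <;> simp [slc] <;> ring_nf <;> simp only [hI] <;> ring
  have s2 : ∀ t : ℂ, aeval (slc ![0, 2 * t ^ 2, 3 * t, 3]) p = 0 := by
    intro t
    refine Eq.trans ?_ (vanish p h ![-1 / 2, -Complex.I / 2, t])
    congr 2
    funext j
    fin_cases j <;> simp [slc] <;> ring_nf <;> simp only [hI] <;> ring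
  have e1 := poly_zero ![27 * k333, 9 * k133, 27 * k033 + 3 * k113, 9 * k013 + k111,
    27 * k003 + 3 * k011, 9 * k001, 27 * k000] (fun t => by
      have := s1 t
      rw [hk] at this
      simp only [Fin.sum_univ_seven, Matrix.cons_val]
      simp
      linear_combination this)
  have e2 := poly_zero ![27 * k333, 27 * k233, 27 * k223 + 18 * k133, 27 * k222 + 18 * k123,
    12 * k113 + 18 * k122, 12 * k112, 8 * k111] (fun t => by
      have := s2 t
      rw [hk] at this
      simp only [Fin.sum_univ_seven, Matrix.cons_val]
      simp
      linear_combination this)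
  have a0 := e1 0
  have a1 := e1 1
  have a2 := e1 2
  have a3 := e1 3
  have a4 := e1 4
  have a5 := e1 5
  have a6 := e1 6
  have b1 := e2 1
  have b2 := e2 2
  have b3 := e2 3
  have b4 := e2 4
  have b5 := e2 5
  have b6 := e2 6
  simp only [Matrix.cons_val] at a0 a1 a2 a3 a4 a5 a6 b1 b2 b3 b4 b5 b6
  refine ⟨![k002, k003, k012, k022, k023, k033, k222 / 2], fun x y z => ?_⟩
  rw [hk]
  simp only [Matrix.cons_val]
  linear_combination (1 / 27) * a6 + (x / 9) * a5 + (x ^ 2 / 3) * a4 + (x * z / 9) * (a3 - b6 / 8) + (x ^ 3 / 8) * b6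
    + (x ^ 2 * z / 3) * a2 + (x * z ^ 2 / 9) * a1 + (z ^ 3 / 27) * a0 + (y * z ^ 2 / 27) * b1
    + (y ^ 2 * z / 27) * (b2 - 2 * a1) + (x * y * z / 18) * b3
    + (x * y ^ 2 / 18) * (b4 - 4 * a2) + (x ^ 2 * y / 12) * b5

set_option maxRecDepth 10000 in
set_option maxHeartbeats 1000000 in
lemma gram_facts (u : Fin 7 → Fin 4 → ℂ) (N : Fin 7 → Fin 7 → ℂ)
    (hN : ∀ i j, N i j = ∑ k, u i k * u j k)
    (H : ∀ x y z : ℂ, ∑ k, (u 0 k * y + u 1 k * (z - 9 * x ^ 2) + u 2 k * (x * y) + u 3 k * y ^ 2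
      + u 4 k * (y * z) + u 5 k * (z ^ 2 - 9 * z * x ^ 2 + 6 * x * y ^ 2)
      + u 6 k * (2 * y ^ 3 - 3 * x * y * z)) ^ 2
      = ((z + 3 * x ^ 2) ^ 3 - 27 * (x * z - y ^ 2 - x ^ 3) ^ 2) / 16) :
    N 0 0 = 0 ∧ N 0 1 = 0 ∧ N 1 1 = 0 ∧ N 0 2 = 0 ∧ N 0 3 = 0 ∧ N 1 2 = 0 ∧ N 1 3 = -N 0 4 ∧ N 2 2 = -18 * N 0 4 ∧ N 1 4 = -N 0 5 ∧ N 2 3 = -6 * N 0 5 ∧ N 1 5 = 1 / 32 ∧ N 3 3 = -27 / 16 - 4 * N 0 6 ∧ N 2 4 = 24 / 16 + 3 * N 0 6 ∧ N 3 4 = -2 * N 1 6 ∧ N 2 5 = 3 * N 1 6 ∧ N 4 4 = -2 * N 3 5 ∧ N 2 6 = -3 * N 3 5 ∧ N 3 6 = 0 ∧ N 4 5 = 0 ∧ N 5 5 = 0 ∧ N 4 6 = 0 ∧ N 5 6 = 0 ∧ N 6 6 = 0 := by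
  have W : ∀ x y z : ℂ, ∀ k : Fin 19, (![0,
      0,
      0,
      0,
      0,
      0,
      N 0 0 * (y * y),
      2 * N 0 1 * (y * (z - 9 * x ^ 2)),
      2 * N 0 2 * (y * (x * y)) + N 1 1 * ((z - 9 * x ^ 2) * (z - 9 * x ^ 2)),
      2 * N 0 3 * (y * y ^ 2) + 2 * N 1 2 * ((z - 9 * x ^ 2) * (x * y)),
      2 * N 0 4 * (y * (y * z)) + 2 * N 1 3 * ((z - 9 * x ^ 2) * y ^ 2) + N 2 2 * ((x * y) * (x * y)),
      2 * N 0 5 * (y * (z ^ 2 - 9 * z * x ^ 2 + 6 * x * y ^ 2)) + 2 * N 1 4 * ((z - 9 * x ^ 2) * (y * z)) + 2 * N 2 3 * ((x * y) * y ^ 2),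
      2 * N 0 6 * (y * (2 * y ^ 3 - 3 * x * y * z)) + 2 * N 1 5 * ((z - 9 * x ^ 2) * (z ^ 2 - 9 * z * x ^ 2 + 6 * x * y ^ 2)) + 2 * N 2 4 * ((x * y) * (y * z)) + N 3 3 * (y ^ 2 * y ^ 2) - (z ^ 3 - 18 * x ^ 2 * z ^ 2 + 81 * x ^ 4 * z - 27 * y ^ 4 + 54 * x * y ^ 2 * z - 54 * x ^ 3 * y ^ 2) / 16,
      2 * N 1 6 * ((z - 9 * x ^ 2) * (2 * y ^ 3 - 3 * x * y * z)) + 2 * N 2 5 * ((x * y) * (z ^ 2 - 9 * z * x ^ 2 + 6 * x * y ^ 2)) + 2 * N 3 4 * (y ^ 2 * (y * z)),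
      2 * N 2 6 * ((x * y) * (2 * y ^ 3 - 3 * x * y * z)) + 2 * N 3 5 * (y ^ 2 * (z ^ 2 - 9 * z * x ^ 2 + 6 * x * y ^ 2)) + N 4 4 * ((y * z) * (y * z)),
      2 * N 3 6 * (y ^ 2 * (2 * y ^ 3 - 3 * x * y * z)) + 2 * N 4 5 * ((y * z) * (z ^ 2 - 9 * z * x ^ 2 + 6 * x * y ^ 2)),
      2 * N 4 6 * ((y * z) * (2 * y ^ 3 - 3 * x * y * z)) + N 5 5 * ((z ^ 2 - 9 * z * x ^ 2 + 6 * x * y ^ 2) * (z ^ 2 - 9 * z * x ^ 2 + 6 * x * y ^ 2)),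
      2 * N 5 6 * ((z ^ 2 - 9 * z * x ^ 2 + 6 * x * y ^ 2) * (2 * y ^ 3 - 3 * x * y * z)),
      N 6 6 * ((2 * y ^ 3 - 3 * x * y * z) * (2 * y ^ 3 - 3 * x * y * z))] : Fin 19 → ℂ) k = 0 := by
    intro x y z
    apply poly_zero
    intro t
    have h := H (t ^ 2 * x) (t ^ 3 * y) (t ^ 4 * z)
    simp only [Fin.sum_univ_four] at h
    simp only [Fin.sum_univ_succ, Fin.sum_univ_zero, Matrix.cons_val_zero, Matrix.cons_val_succ,
      Fin.val_zero, Fin.val_succ]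
    simp only [hN, Fin.sum_univ_four]
    linear_combination h
  have P0 := fun x y z : ℂ => W x y z 6
  have P1 := fun x y z : ℂ => W x y z 7
  have P2 := fun x y z : ℂ => W x y z 8
  have P3 := fun x y z : ℂ => W x y z 9
  have P4 := fun x y z : ℂ => W x y z 10
  have P5 := fun x y z : ℂ => W x y z 11
  have P6 := fun x y z : ℂ => W x y z 12
  have P7 := fun x y z : ℂ => W x y z 13
  have P8 := fun x y z : ℂ => W x y z 14
  have P9 := fun x y z : ℂ => W x y z 15
  have P10 := fun x y z : ℂ => W x y z 16
  have P11 := fun x y z : ℂ => W x y z 17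
  have P12 := fun x y z : ℂ => W x y z 18
  simp only [Matrix.cons_val] at P0 P1 P2 P3 P4 P5 P6 P7 P8 P9 P10 P11 P12
  have h00 : N 0 0 = 0 := by
    linear_combination (P0 0 1 0)
  have h01 : N 0 1 = 0 := by
    linear_combination (1/2)*(P1 0 1 1)
  have h11 : N 1 1 = 0 := by
    linear_combination (P2 0 0 1)
  have h02 : N 0 2 = 0 := by
    linear_combination (1/2)*(P2 1 1 9)
  have h03 : N 0 3 = 0 := by
    linear_combination (1/2)*(P3 0 1 0)
  have h12 : N 1 2 = 0 := by
    linear_combination (1/2)*(P3 1 1 10) - h03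
  have h13 : N 1 3 = -N 0 4 := by
    linear_combination (1/2)*(P4 0 1 1)
  have h22 : N 2 2 = -18 * N 0 4 := by
    linear_combination (P4 1 1 0) + 18*h13
  have h14 : N 1 4 = -N 0 5 := by
    linear_combination (1/2)*(P5 0 1 1)
  have h23 : N 2 3 = -6 * N 0 5 := by
    linear_combination (1/2)*(P5 1 1 0)
  have h15 : N 1 5 = 1 / 32 := by
    linear_combination (1/2)*(P6 0 0 1)
  have h33 : N 3 3 = -27 / 16 - 4 * N 0 6 := by
    linear_combination (P6 0 1 0)
  have h24 : N 2 4 = 24 / 16 + 3 * N 0 6 := by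
    linear_combination (1/2)*(P6 1 1 1) - (1/2)*h33 - 16*h15
  have h34 : N 3 4 = -2 * N 1 6 := by
    linear_combination (1/2)*(P7 0 1 1)
  have h25 : N 2 5 = 3 * N 1 6 := by
    linear_combination -(1/4)*(P7 1 1 1) + (1/2)*h34
  have h44 : N 4 4 = -2 * N 3 5 := by
    linear_combination (P8 0 1 1)
  have h26 : N 2 6 = -3 * N 3 5 := by
    linear_combination (1/4)*(P8 1 1 0)
  have h36 : N 3 6 = 0 := by
    linear_combination (1/4)*(P9 0 1 0)
  have h45 : N 4 5 = 0 := by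
    linear_combination (1/2)*(P9 0 1 1) - 2*h36
  have h55 : N 5 5 = 0 := by
    linear_combination (P10 0 0 1)
  have h46 : N 4 6 = 0 := by
    linear_combination (1/4)*(P10 0 1 1) - (1/4)*h55
  have h56 : N 5 6 = 0 := by
    linear_combination (1/4)*(P11 0 1 1)
  have h66 : N 6 6 = 0 := by
    linear_combination (1/4)*(P12 0 1 0)
  exact ⟨h00, h01, h11, h02, h03, h12, h13, h22, h14, h23, h15, h33, h24, h34, h25, h44, h26, h36, h45, h55, h46, h56, h66⟩

lemma gram_false (u : Fin 7 → Fin 4 → ℂ)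
    (H : ∀ x y z : ℂ, ∑ k, (u 0 k * y + u 1 k * (z - 9 * x ^ 2) + u 2 k * (x * y) + u 3 k * y ^ 2
      + u 4 k * (y * z) + u 5 k * (z ^ 2 - 9 * z * x ^ 2 + 6 * x * y ^ 2)
      + u 6 k * (2 * y ^ 3 - 3 * x * y * z)) ^ 2
      = ((z + 3 * x ^ 2) ^ 3 - 27 * (x * z - y ^ 2 - x ^ 3) ^ 2) / 16) : False := by
  obtain ⟨N, hN⟩ : ∃ N : Fin 7 → Fin 7 → ℂ, ∀ i j, N i j = ∑ k, u i k * u j k := ⟨_, fun _ _ => rfl⟩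
  obtain ⟨h00, h01, h11, h02, h03, h12, h13, h22, h14, h23, h15, h33, h24, h34, h25, h44, h26, h36, h45, h55, h46, h56, h66⟩ := gram_facts u N hN H
  have hs : ∀ i j, N i j = N j i := by
    intro i j
    rw [hN, hN]
    exact Finset.sum_congr rfl fun k _ => mul_comm _ _
  have R : ∀ s t : Fin 5 → Fin 7, (∀ i, N (s i) (t i) ≠ 0) →
      (∀ i j, i < j → N (s i) (t j) = 0) → False := by
    intro s t h1 h2
    refine rank_aux (fun i => u (s i)) (fun i => u (t i)) (fun i => ?_) (fun i j hij => ?_)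
    · rw [← hN]; exact h1 i
    · rw [← hN]; exact h2 i j hij
  have zlo : ∀ i j : Fin 7, (i : ℕ) + j < 4 → N i j = 0 := by
    intro i j hij
    fin_cases i <;> fin_cases j <;>
      first
      | (exfalso; revert hij; decide)
      | (simp only [Fin.zero_eta, Fin.mk_one, Fin.reduceFinMk]; assumption)
      | (simp only [Fin.zero_eta, Fin.mk_one, Fin.reduceFinMk]; rw [hs]; assumption)
  have zhi : ∀ i j : Fin 7, 8 < (i : ℕ) + j → N i j = 0 := by
    intro i j hij
    fin_cases i <;> fin_cases j <;>
      first
      | (exfalso; revert hij; decide)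
      | (simp only [Fin.zero_eta, Fin.mk_one, Fin.reduceFinMk]; assumption)
      | (simp only [Fin.zero_eta, Fin.mk_one, Fin.reduceFinMk]; rw [hs]; assumption)
  have h04 : N 0 4 = 0 := by
    by_contra hne
    refine R ![0, 1, 2, 3, 4] ![4, 3, 2, 1, 0] (fun i => ?_) (fun i j hij => zlo _ _ ?_)
    · fin_cases i <;> simp [h13, h22, hs 3 1, hs 4 0, hne]
    · revert i j; decide
  have h35 : N 3 5 = 0 := by
    by_contra hne
    refine R ![6, 5, 4, 3, 2] ![2, 3, 4, 5, 6] (fun i => ?_) (fun i j hij => zhi _ _ ?_)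
    · fin_cases i <;> simp [h44, h26, hs 6 2, hs 5 3, hne]
    · revert i j; decide
  rw [h04] at h13 h22
  rw [h35] at h44 h26
  norm_num at h13 h22 h44 h26
  have zlo : ∀ i j : Fin 7, (i : ℕ) + j < 5 → N i j = 0 := by
    intro i j hij
    fin_cases i <;> fin_cases j <;>
      first
      | (exfalso; revert hij; decide)
      | (simp only [Fin.zero_eta, Fin.mk_one, Fin.reduceFinMk]; assumption)
      | (simp only [Fin.zero_eta, Fin.mk_one, Fin.reduceFinMk]; rw [hs]; assumption)
  have zhi : ∀ i j : Fin 7, 7 < (i : ℕ) + j → N i j = 0 := by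
    intro i j hij
    fin_cases i <;> fin_cases j <;>
      first
      | (exfalso; revert hij; decide)
      | (simp only [Fin.zero_eta, Fin.mk_one, Fin.reduceFinMk]; assumption)
      | (simp only [Fin.zero_eta, Fin.mk_one, Fin.reduceFinMk]; rw [hs]; assumption)
  have h05 : N 0 5 = 0 := by
    by_contra hne
    refine R ![0, 1, 2, 3, 4] ![5, 4, 3, 2, 1] (fun i => ?_) (fun i j hij => zlo _ _ ?_)
    · fin_cases i <;> simp [h14, h23, hs 3 2, hs 4 1, hne]
    · revert i j; decide
  have h16 : N 1 6 = 0 := by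
    by_contra hne
    refine R ![6, 5, 4, 3, 2] ![1, 2, 3, 4, 5] (fun i => ?_) (fun i j hij => zhi _ _ ?_)
    · fin_cases i <;> simp [h34, h25, hs 6 1, hs 5 2, hs 4 3, hne]
    · revert i j; decide
  rw [h05] at h14 h23
  rw [h16] at h34 h25
  norm_num at h14 h23 h34 h25
  have z : ∀ i j : Fin 7, (i : ℕ) + j ≠ 6 → N i j = 0 := by
    intro i j hij
    fin_cases i <;> fin_cases j <;>
      first
      | (exfalso; revert hij; decide)
      | (simp only [Fin.zero_eta, Fin.mk_one, Fin.reduceFinMk]; assumption)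
      | (simp only [Fin.zero_eta, Fin.mk_one, Fin.reduceFinMk]; rw [hs]; assumption)
  by_cases g0 : N 0 6 = 0
  · rw [g0] at h33 h24
    refine R ![1, 2, 3, 4, 5] ![5, 4, 3, 2, 1] (fun i => ?_) (fun i j hij => z _ _ ?_)
    · fin_cases i <;> simp [h15, h24, h33, hs 5 1, hs 4 2]
    · revert i j; decide
  by_cases g3 : N 3 3 = 0
  · have g2 : N 2 4 ≠ 0 := by
      intro h
      have : (1 : ℂ) = 0 := by linear_combination (-16 / 15) * (4 * (h24 - h) + 3 * (h33 - g3))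
      exact one_ne_zero this
    refine R ![0, 1, 2, 4, 5] ![6, 5, 4, 2, 1] (fun i => ?_) (fun i j hij => z _ _ ?_)
    · fin_cases i <;> simp [h15, g2, g0, hs 5 1, hs 4 2]
    · revert i j; decide
  · refine R ![0, 1, 3, 5, 6] ![6, 5, 3, 1, 0] (fun i => ?_) (fun i j hij => z _ _ ?_)
    · fin_cases i <;> simp [h15, g3, g0, hs 5 1, hs 6 0]
    · revert i j; decide

lemma real_disc (x : Fin 5 → ℝ) : eval x (-4 * pPoly^3 - 27 * qPoly^2) =
    -4 * (-x 0^2 - x 0*x 1 - x 1^2 - x 2^2 - x 3^2 - x 4^2)^3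
    - 27 * (x 0^2*x 1 + x 0*x 1^2 - x 0*x 2^2 + x 0*x 4^2 - x 1*x 2^2 + x 1*x 3^2
      - 2*x 2*x 3*x 4)^2 := by
  simp [pPoly, qPoly, a, b, d, e, f]

lemma cplx_disc (x : Fin 5 → ℂ) : aeval x (-4 * pPoly^3 - 27 * qPoly^2) =
    -4 * (-x 0^2 - x 0*x 1 - x 1^2 - x 2^2 - x 3^2 - x 4^2)^3
    - 27 * (x 0^2*x 1 + x 0*x 1^2 - x 0*x 2^2 + x 0*x 4^2 - x 1*x 2^2 + x 1*x 3^2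
      - 2*x 2*x 3*x 4)^2 := by
  simp [pPoly, qPoly, a, b, d, e, f]

/-- The discriminant `-4p³ - 27q²` of `3×3` trace-zero real symmetric matrices cannot be
written as a sum of four (or fewer) squares of real polynomials, so `μ(3) = 5`. -/
theorem discriminant_three_not_sum_four_squares :
    ¬ ∃ f₁ f₂ f₃ f₄ : MvPolynomial (Fin 5) ℝ,
      -4 * pPoly^3 - 27 * qPoly^2 = f₁^2 + f₂^2 + f₃^2 + f₄^2 := by
  rintro ⟨f₁, f₂, f₃, f₄, h⟩
  obtain ⟨F, hF⟩ : ∃ F : Fin 4 → MvPolynomial (Fin 5) ℝ,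
      ∑ i, F i ^ 2 = -4 * pPoly^3 - 27 * qPoly^2 :=
    ⟨![f₁, f₂, f₃, f₄], by rw [h, Fin.sum_univ_four]; rfl⟩
  have hhom := hom_aux F _ disc_hom hF
  have hv : ∀ i, ∀ v : Fin 3 → ℝ, eval ![2 * v 0 ^ 2 - v 1 ^ 2 - v 2 ^ 2,
      2 * v 1 ^ 2 - v 0 ^ 2 - v 2 ^ 2, 3 * v 0 * v 1, 3 * v 0 * v 2, 3 * v 1 * v 2] (F i) = 0 := by
    intro i v
    have h1 := congrArg (eval ![2 * v 0 ^ 2 - v 1 ^ 2 - v 2 ^ 2,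
      2 * v 1 ^ 2 - v 0 ^ 2 - v 2 ^ 2, 3 * v 0 * v 1, 3 * v 0 * v 2, 3 * v 1 * v 2]) hF
    rw [real_disc, map_sum] at h1
    simp only [map_pow, Matrix.cons_val] at h1
    have h2 : ∑ i, (eval ![2 * v 0 ^ 2 - v 1 ^ 2 - v 2 ^ 2,
      2 * v 1 ^ 2 - v 0 ^ 2 - v 2 ^ 2, 3 * v 0 * v 1, 3 * v 0 * v 2, 3 * v 1 * v 2] (F i)) ^ 2
      = 0 := by
      rw [h1]; ring
    rw [Finset.sum_eq_zero_iff_of_nonneg (fun j _ => sq_nonneg _)] at h2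
    exact pow_eq_zero_iff (two_ne_zero) |>.1 (h2 i (Finset.mem_univ i))
  choose u hu using fun i => shape (F i) (hhom i) (hv i)
  apply gram_false (fun j k => u k j)
  intro x y z
  have h1 := congrArg (aeval (slc ![1, x, y, z])) hF
  rw [cplx_disc, map_sum] at h1
  simp only [map_pow, hu] at h1
  rw [h1]
  simp only [slc, Matrix.cons_val]
  have hI := Complex.I_sq
  have e1 : -((1 + z) / 4 - x / 2) ^ 2 - ((1 + z) / 4 - x / 2) * (-x / 2 - (1 + z) / 4)
      - (-x / 2 - (1 + z) / 4) ^ 2 - (-Complex.I * (1 - z) / 4) ^ 2 - (-y / 2) ^ 2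
      - (-Complex.I * y / 2) ^ 2 = -(z + 3 * x ^ 2) / 4 := by
    linear_combination (-(1 - z) ^ 2 / 16 - y ^ 2 / 4) * hI
  have e2 : ((1 + z) / 4 - x / 2) ^ 2 * (-x / 2 - (1 + z) / 4)
      + ((1 + z) / 4 - x / 2) * (-x / 2 - (1 + z) / 4) ^ 2
      - ((1 + z) / 4 - x / 2) * (-Complex.I * (1 - z) / 4) ^ 2
      + ((1 + z) / 4 - x / 2) * (-Complex.I * y / 2) ^ 2
      - (-x / 2 - (1 + z) / 4) * (-Complex.I * (1 - z) / 4) ^ 2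
      + (-x / 2 - (1 + z) / 4) * (-y / 2) ^ 2
      - 2 * (-Complex.I * (1 - z) / 4) * (-y / 2) * (-Complex.I * y / 2)
      = (x * z - y ^ 2 - x ^ 3) / 4 := by
    ring_nf
    simp only [hI]
    ring
  rw [e1, e2]
  ring
end

section
/- For n = 3, let W be the 7-dimensional space of polynomial functions on N that are homogeneous of degree 3 and vanish identically on F, and let L : Sym²(W) → R[N] be the linear map from the symmetric tensor square of W induced by multiplication of polynomials, (f_1, f_2) ↦ f_1·f_2. Then the kernel of L has dimension 5; equivalently, the linear span of the set of products {f·g : f, g ∈ W} has dimension 23. -/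
open Matrix BigOperators

/-- `H_2(A) = A² - (Tr(A²)/3)·I` as a trace-zero symmetric matrix. -/
noncomputable def H2 (A : ↥(symTraceless 3)) : ↥(symTraceless 3) :=
  ⟨A.1 ^ 2 - ((A.1 ^ 2).trace / 3) • 1, by
    obtain ⟨h1, h2⟩ := mem_symTraceless.mp A.2
    refine mem_symTraceless.mpr ⟨?_, ?_⟩
    · rw [Matrix.IsSymm, Matrix.transpose_sub, Matrix.transpose_smul, Matrix.transpose_one,
        Matrix.transpose_pow, h1]
    · rw [Matrix.trace_sub, Matrix.trace_smul, Matrix.trace_one]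
      simp only [Fintype.card_fin, smul_eq_mul]
      push_cast
      ring⟩

/-- The wedge product `A ∧ B` in `⋀² N`. -/
noncomputable def wedge2 (A B : ↥(symTraceless 3)) : ↥(⋀[ℝ]^2 ↥(symTraceless 3)) :=
  ⟨ExteriorAlgebra.ιMulti ℝ 2 ![A, B], ExteriorAlgebra.ιMulti_range ℝ 2 ⟨![A, B], rfl⟩⟩

/-- The space of polynomial functions on `N` (for `n = 3`) that are homogeneous of degree 3
and vanish on the set of degenerate matrices. -/
noncomputable def idealF3 : Submodule ℝ (↥(symTraceless 3) → ℝ) where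
  carrier := {f | (∃ p : MvPolynomial (Fin 3 × Fin 3) ℝ, p.IsHomogeneous 3 ∧
      ∀ A : ↥(symTraceless 3), f A = evalMat p A.1) ∧
    ∀ A : ↥(symTraceless 3), Degen A → f A = 0}
  add_mem' := by
    rintro f g ⟨⟨p, hp, hfp⟩, hf⟩ ⟨⟨q, hq, hgq⟩, hg⟩
    refine ⟨⟨p + q, hp.add hq, fun A => ?_⟩, fun A hA => ?_⟩
    · simp only [Pi.add_apply, evalMat, map_add, hfp A, hgq A]
    · simp only [Pi.add_apply, hf A hA, hg A hA, add_zero]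
  zero_mem' := by
    refine ⟨⟨0, MvPolynomial.isHomogeneous_zero _ _ _, fun A => ?_⟩, fun A _ => rfl⟩
    simp [evalMat]
  smul_mem' := by
    rintro c f ⟨⟨p, hp, hfp⟩, hf⟩
    refine ⟨⟨c • p, by rw [MvPolynomial.smul_eq_C_mul]; exact hp.C_mul c, fun A => ?_⟩,
      fun A hA => ?_⟩
    · simp only [Pi.smul_apply, evalMat, MvPolynomial.smul_eval, hfp A, smul_eq_mul]
    · simp only [Pi.smul_apply, hf A hA, smul_zero]

def cub (d : Fin 35 → ℝ) (a b x y z : ℝ) : ℝ :=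
  d 0*(a^3) +
  d 1*(a^2*b) +
  d 2*(a^2*x) +
  d 3*(a^2*y) +
  d 4*(a^2*z) +
  d 5*(a*b^2) +
  d 6*(a*b*x) +
  d 7*(a*b*y) +
  d 8*(a*b*z) +
  d 9*(a*x^2) +
  d 10*(a*x*y) +
  d 11*(a*x*z) +
  d 12*(a*y^2) +
  d 13*(a*y*z) +
  d 14*(a*z^2) +
  d 15*(b^3) +
  d 16*(b^2*x) +
  d 17*(b^2*y) +
  d 18*(b^2*z) +
  d 19*(b*x^2) +
  d 20*(b*x*y) +
  d 21*(b*x*z) +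
  d 22*(b*y^2) +
  d 23*(b*y*z) +
  d 24*(b*z^2) +
  d 25*(x^3) +
  d 26*(x^2*y) +
  d 27*(x^2*z) +
  d 28*(x*y^2) +
  d 29*(x*y*z) +
  d 30*(x*z^2) +
  d 31*(y^3) +
  d 32*(y^2*z) +
  d 33*(y*z^2) +
  d 34*(z^3)

def wpoly (a b x y z : ℝ) : Fin 7 → ℝ :=
  ![(a-b)*(a*a+z*z-(-a-b)*(-a-b)-x*x)-(a-(-a-b))*(a*a+y*y-b*b-x*x),
    (b-(-a-b))*y*z+x*(y*y-z*z),
    (a-b)*y*z-x*(a-b)*(a-(-a-b))+x*(x*x-y*y),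
    ((-a-b)-a)*z*x+y*(z*z-x*x),
    (b-(-a-b))*z*x-y*(b-(-a-b))*(b-a)+y*(y*y-z*z),
    (a-b)*x*y+z*(x*x-y*y),
    ((-a-b)-a)*x*y-z*((-a-b)-a)*((-a-b)-b)+z*(z*z-x*x)]

theorem cub_solve (d : Fin 35 → ℝ)
    (h0 : ∀ p q r : ℝ, cub d (3*p^2-(p^2+q^2+r^2)) (3*q^2-(p^2+q^2+r^2)) (3*q*r) (3*p*r) (3*p*q) = 0) :
    ∃ c : Fin 7 → ℝ, ∀ a b x y z : ℝ, cub d a b x y z = ∑ i, c i * wpoly a b x y z i := by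
  have h := h0
  simp only [cub] at h
  have hA : ∀ p q r : ℝ, d 0*((3*p^2-(p^2+q^2+r^2))*(3*p^2-(p^2+q^2+r^2))*(3*p^2-(p^2+q^2+r^2))) + d 1*((3*p^2-(p^2+q^2+r^2))*(3*p^2-(p^2+q^2+r^2))*(3*q^2-(p^2+q^2+r^2))) + d 5*((3*p^2-(p^2+q^2+r^2))*(3*q^2-(p^2+q^2+r^2))*(3*q^2-(p^2+q^2+r^2))) + d 9*((3*p^2-(p^2+q^2+r^2))*(3*q*r)*(3*q*r)) + d 12*((3*p^2-(p^2+q^2+r^2))*(3*p*r)*(3*p*r)) + d 14*((3*p^2-(p^2+q^2+r^2))*(3*p*q)*(3*p*q)) + d 15*((3*q^2-(p^2+q^2+r^2))*(3*q^2-(p^2+q^2+r^2))*(3*q^2-(p^2+q^2+r^2))) + d 19*((3*q^2-(p^2+q^2+r^2))*(3*q*r)*(3*q*r)) + d 22*((3*q^2-(p^2+q^2+r^2))*(3*p*r)*(3*p*r)) + d 24*((3*q^2-(p^2+q^2+r^2))*(3*p*q)*(3*p*q)) + d 29*((3*q*r)*(3*p*r)*(3*p*q)) = 0 := by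
    intro p q r
    linear_combination (1/4)*(h p q r + h (-p) q r + h p (-q) r + h p q (-r))
  have e1 : d 1 = (3/2)*d 0 := by linear_combination (-2/9)*hA 0 0 1 + (-1/18)*hA 0 1 0 + (-2/9)*hA 1 0 0
  have e5 : d 5 = (-3/2)*d 0 := by linear_combination (-5/9)*hA 0 0 1 + (-1/18)*hA 0 1 0 + (1/9)*hA 1 0 0
  have e9 : d 9 = (-1/2)*d 0 := by linear_combination (2/27)*hA 0 0 1 + (1/108)*hA 0 1 0 + (-2/81)*hA 0 1 1 + (-1/324)*hA 0 1 2
  have e12 : d 12 = (1)*d 0 := by linear_combination (10/27)*hA 0 0 1 + (-5/54)*hA 1 0 0 + (5/81)*hA 1 0 1 + (-1/162)*hA 1 0 2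
  have e14 : d 14 = (-1/2)*d 0 := by linear_combination (7/54)*hA 0 1 0 + (7/108)*hA 1 0 0 + (7/81)*hA 1 1 0 + (-1/324)*hA 1 2 0
  have e15 : d 15 = (-1)*d 0 := by linear_combination (-2/9)*hA 0 0 1 + (1/9)*hA 0 1 0 + (1/9)*hA 1 0 0
  have e19 : d 19 = (-1)*d 0 := by linear_combination (4/27)*hA 0 0 1 + (1/54)*hA 0 1 0 + (1/9)*hA 1 0 0 + (5/81)*hA 0 1 1 + (-1/162)*hA 0 1 2
  have e22 : d 22 = (1/2)*d 0 := by linear_combination (5/27)*hA 0 0 1 + (-1/18)*hA 0 1 0 + (-5/108)*hA 1 0 0 + (-2/81)*hA 1 0 1 + (-1/324)*hA 1 0 2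
  have e24 : d 24 = (1/2)*d 0 := by linear_combination (1/9)*hA 0 0 1 + (-7/54)*hA 0 1 0 + (-7/108)*hA 1 0 0 + (2/81)*hA 1 1 0 + (1/324)*hA 1 2 0
  have e29 : d 29 = 0 := by linear_combination (1/27)*hA 1 1 1
  have hX : ∀ p q r : ℝ, d 2*((3*p^2-(p^2+q^2+r^2))*(3*p^2-(p^2+q^2+r^2))*(3*q*r)) + d 6*((3*p^2-(p^2+q^2+r^2))*(3*q^2-(p^2+q^2+r^2))*(3*q*r)) + d 13*((3*p^2-(p^2+q^2+r^2))*(3*p*r)*(3*p*q)) + d 16*((3*q^2-(p^2+q^2+r^2))*(3*q^2-(p^2+q^2+r^2))*(3*q*r)) + d 23*((3*q^2-(p^2+q^2+r^2))*(3*p*r)*(3*p*q)) + d 25*((3*q*r)*(3*q*r)*(3*q*r)) + d 28*((3*q*r)*(3*p*r)*(3*p*r)) + d 30*((3*q*r)*(3*p*q)*(3*p*q)) = 0 := by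
    intro p q r
    linear_combination (1/4)*(h p q r + h (-p) q r - h p (-q) r - h p q (-r))
  have e2 : d 2 = (-2)*d 25 := by linear_combination (14/243)*hX 0 1 1 + (7/2430)*hX 0 1 2 + (-1/1215)*hX 0 2 1
  have e6 : d 6 = (1)*d 25 := by linear_combination (-25/243)*hX 0 1 1 + (19/2430)*hX 0 1 2 + (1/2430)*hX 0 2 1
  have e13 : d 13 = (-1)*d 30 + (1)*d 25 := by linear_combination (-4/27)*hX 0 1 1 + (1/90)*hX 0 1 2 + (1/135)*hX 0 2 1 + (1/9)*hX 1 1 1 + (-1/81)*hX 1 1 2 + (-1/162)*hX 1 2 1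
  have e16 : d 16 = (1)*d 25 := by linear_combination (-25/243)*hX 0 1 1 + (1/243)*hX 0 1 2 + (1/243)*hX 0 2 1
  have e23 : d 23 = (-2)*d 30 + (-1)*d 25 := by linear_combination (1/270)*hX 0 1 2 + (-1/270)*hX 0 2 1 + (1/27)*hX 1 1 1 + (-1/162)*hX 1 1 2 + (1/162)*hX 1 2 1
  have e28 : d 28 = (-1)*d 30 + (-1)*d 25 := by linear_combination (1/27)*hX 1 1 1
  have hY : ∀ p q r : ℝ, d 3*((3*p^2-(p^2+q^2+r^2))*(3*p^2-(p^2+q^2+r^2))*(3*p*r)) + d 7*((3*p^2-(p^2+q^2+r^2))*(3*q^2-(p^2+q^2+r^2))*(3*p*r)) + d 11*((3*p^2-(p^2+q^2+r^2))*(3*q*r)*(3*p*q)) + d 17*((3*q^2-(p^2+q^2+r^2))*(3*q^2-(p^2+q^2+r^2))*(3*p*r)) + d 21*((3*q^2-(p^2+q^2+r^2))*(3*q*r)*(3*p*q)) + d 26*((3*q*r)*(3*q*r)*(3*p*r)) + d 31*((3*p*r)*(3*p*r)*(3*p*r)) + d 33*((3*p*r)*(3*p*q)*(3*p*q)) = 0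 := by
    intro p q r
    linear_combination (1/4)*(h p q r - h (-p) q r + h p (-q) r - h p q (-r))
  have e3 : d 3 = (1)*d 31 := by linear_combination (-25/243)*hY 1 0 1 + (1/243)*hY 1 0 2 + (1/243)*hY 2 0 1
  have e7 : d 7 = (1)*d 31 := by linear_combination (-25/243)*hY 1 0 1 + (19/2430)*hY 1 0 2 + (1/2430)*hY 2 0 1
  have e11 : d 11 = (2)*d 26 + (1)*d 31 := by linear_combination (-23/324)*hY 1 0 1 + (4/405)*hY 1 0 2 + (1/405)*hY 2 0 1 + (1/27)*hY 1 1 1 + (-1/81)*hY 1 1 2 + (-1/324)*hY 1 2 1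
  have e17 : d 17 = (-2)*d 31 := by linear_combination (14/243)*hY 1 0 1 + (7/2430)*hY 1 0 2 + (-1/1215)*hY 2 0 1
  have e21 : d 21 = (1)*d 26 + (2)*d 31 := by linear_combination (-25/324)*hY 1 0 1 + (2/405)*hY 1 0 2 + (1/810)*hY 2 0 1 + (-1/162)*hY 1 1 2 + (1/324)*hY 1 2 1
  have e33 : d 33 = (-1)*d 26 + (-1)*d 31 := by linear_combination (1/27)*hY 1 1 1
  have hZ : ∀ p q r : ℝ, d 4*((3*p^2-(p^2+q^2+r^2))*(3*p^2-(p^2+q^2+r^2))*(3*p*q)) + d 8*((3*p^2-(p^2+q^2+r^2))*(3*q^2-(p^2+q^2+r^2))*(3*p*q)) + d 10*((3*p^2-(p^2+q^2+r^2))*(3*q*r)*(3*p*r)) + d 18*((3*q^2-(p^2+q^2+r^2))*(3*q^2-(p^2+q^2+r^2))*(3*p*q)) + d 20*((3*q^2-(p^2+q^2+r^2))*(3*q*r)*(3*p*r)) + d 27*((3*q*r)*(3*q*r)*(3*p*q)) + d 32*((3*p*r)*(3*p*r)*(3*p*q)) + d 34*((3*p*q)*(3*p*q)*(3*p*q)) =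 0 := by
    intro p q r
    linear_combination (1/4)*(h p q r - h (-p) q r - h p (-q) r + h p q (-r))
  have e4 : d 4 = (-2)*d 34 := by linear_combination (14/243)*hZ 1 1 0 + (-1/1215)*hZ 1 2 0 + (7/2430)*hZ 2 1 0
  have e8 : d 8 = (-5)*d 34 := by linear_combination (53/243)*hZ 1 1 0 + (-1/486)*hZ 1 2 0 + (-1/486)*hZ 2 1 0
  have e10 : d 10 = (-1)*d 32 + (-2)*d 34 := by linear_combination (1/162)*hZ 1 1 0 + (2/405)*hZ 1 2 0 + (1/810)*hZ 2 1 0 + (2/27)*hZ 1 1 1 + (-1/162)*hZ 1 1 2 + (-1/162)*hZ 1 2 1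
  have e18 : d 18 = (-2)*d 34 := by linear_combination (14/243)*hZ 1 1 0 + (7/2430)*hZ 1 2 0 + (-1/1215)*hZ 2 1 0
  have e20 : d 20 = (1)*d 32 + (-1)*d 34 := by linear_combination (25/324)*hZ 1 1 0 + (-2/405)*hZ 1 2 0 + (-1/810)*hZ 2 1 0 + (-1/27)*hZ 1 1 1 + (-1/324)*hZ 1 1 2 + (1/162)*hZ 1 2 1
  have e27 : d 27 = (-1)*d 32 + (-1)*d 34 := by linear_combination (1/27)*hZ 1 1 1
  refine ⟨![(-1/2)*d 0, (-1)*d 30, (1)*d 25, (-1)*d 26, (1)*d 31, (-1)*d 32, (1)*d 34], fun a b x y z => ?_⟩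
  rw [cub, e1, e2, e3, e4, e5, e6, e7, e8, e9, e10, e11, e12, e13, e14, e15, e16, e17, e18, e19, e20, e21, e22, e23, e24, e27, e28, e29, e33]
  simp [Fin.sum_univ_succ, wpoly]
  ring

theorem cub_prod (l m n : Fin 5 → ℝ) : ∃ d : Fin 35 → ℝ, ∀ a b x y z : ℝ,
    (l 0*a+l 1*b+l 2*x+l 3*y+l 4*z)*(m 0*a+m 1*b+m 2*x+m 3*y+m 4*z)*(n 0*a+n 1*b+n 2*x+n 3*y+n 4*z)
      = cub d a b x y z := by
  refine ⟨![l 0*m 0*n 0,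
    l 0*m 0*n 1 + l 0*m 1*n 0 + l 1*m 0*n 0,
    l 0*m 0*n 2 + l 0*m 2*n 0 + l 2*m 0*n 0,
    l 0*m 0*n 3 + l 0*m 3*n 0 + l 3*m 0*n 0,
    l 0*m 0*n 4 + l 0*m 4*n 0 + l 4*m 0*n 0,
    l 0*m 1*n 1 + l 1*m 0*n 1 + l 1*m 1*n 0,
    l 0*m 1*n 2 + l 0*m 2*n 1 + l 1*m 0*n 2 + l 1*m 2*n 0 + l 2*m 0*n 1 + l 2*m 1*n 0,
    l 0*m 1*n 3 + l 0*m 3*n 1 + l 1*m 0*n 3 + l 1*m 3*n 0 + l 3*m 0*n 1 + l 3*m 1*n 0,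
    l 0*m 1*n 4 + l 0*m 4*n 1 + l 1*m 0*n 4 + l 1*m 4*n 0 + l 4*m 0*n 1 + l 4*m 1*n 0,
    l 0*m 2*n 2 + l 2*m 0*n 2 + l 2*m 2*n 0,
    l 0*m 2*n 3 + l 0*m 3*n 2 + l 2*m 0*n 3 + l 2*m 3*n 0 + l 3*m 0*n 2 + l 3*m 2*n 0,
    l 0*m 2*n 4 + l 0*m 4*n 2 + l 2*m 0*n 4 + l 2*m 4*n 0 + l 4*m 0*n 2 + l 4*m 2*n 0,
    l 0*m 3*n 3 + l 3*m 0*n 3 + l 3*m 3*n 0,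
    l 0*m 3*n 4 + l 0*m 4*n 3 + l 3*m 0*n 4 + l 3*m 4*n 0 + l 4*m 0*n 3 + l 4*m 3*n 0,
    l 0*m 4*n 4 + l 4*m 0*n 4 + l 4*m 4*n 0,
    l 1*m 1*n 1,
    l 1*m 1*n 2 + l 1*m 2*n 1 + l 2*m 1*n 1,
    l 1*m 1*n 3 + l 1*m 3*n 1 + l 3*m 1*n 1,
    l 1*m 1*n 4 + l 1*m 4*n 1 + l 4*m 1*n 1,
    l 1*m 2*n 2 + l 2*m 1*n 2 + l 2*m 2*n 1,
    l 1*m 2*n 3 + l 1*m 3*n 2 + l 2*m 1*n 3 + l 2*m 3*n 1 + l 3*m 1*n 2 + l 3*m 2*n 1,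
    l 1*m 2*n 4 + l 1*m 4*n 2 + l 2*m 1*n 4 + l 2*m 4*n 1 + l 4*m 1*n 2 + l 4*m 2*n 1,
    l 1*m 3*n 3 + l 3*m 1*n 3 + l 3*m 3*n 1,
    l 1*m 3*n 4 + l 1*m 4*n 3 + l 3*m 1*n 4 + l 3*m 4*n 1 + l 4*m 1*n 3 + l 4*m 3*n 1,
    l 1*m 4*n 4 + l 4*m 1*n 4 + l 4*m 4*n 1,
    l 2*m 2*n 2,
    l 2*m 2*n 3 + l 2*m 3*n 2 + l 3*m 2*n 2,
    l 2*m 2*n 4 + l 2*m 4*n 2 + l 4*m 2*n 2,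
    l 2*m 3*n 3 + l 3*m 2*n 3 + l 3*m 3*n 2,
    l 2*m 3*n 4 + l 2*m 4*n 3 + l 3*m 2*n 4 + l 3*m 4*n 2 + l 4*m 2*n 3 + l 4*m 3*n 2,
    l 2*m 4*n 4 + l 4*m 2*n 4 + l 4*m 4*n 2,
    l 3*m 3*n 3,
    l 3*m 3*n 4 + l 3*m 4*n 3 + l 4*m 3*n 3,
    l 3*m 4*n 4 + l 4*m 3*n 4 + l 4*m 4*n 3,
    l 4*m 4*n 4], fun a b x y z => ?_⟩
  simp only [cub, Matrix.cons_val]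
  ring


theorem degen_of_quad (A : ↥(symTraceless 3)) (s t : ℝ)
    (h : A.1 * A.1 = s • A.1 + t • (1 : Matrix (Fin 3) (Fin 3) ℝ)) : Degen A := by
  have hA := isHermitian_of_isSymm (mem_symTraceless.mp A.2).1
  have key : ∀ k, eigsN A k * eigsN A k = s * eigsN A k + t := by
    intro k
    have h1 := hA.mulVec_eigenvectorBasis k
    have h2 : (A.1 * A.1) *ᵥ ⇑(hA.eigenvectorBasis k) =
        (hA.eigenvalues k * hA.eigenvalues k) • ⇑(hA.eigenvectorBasis k) := by
      rw [← Matrix.mulVec_mulVec, h1, Matrix.mulVec_smul, h1, smul_smul]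
    rw [h, Matrix.add_mulVec, Matrix.smul_mulVec, Matrix.smul_mulVec, h1, Matrix.one_mulVec,
      smul_smul, ← add_smul] at h2
    have hne : hA.eigenvectorBasis k ≠ 0 := by
      have := hA.eigenvectorBasis.toBasis.ne_zero k
      simpa using this
    have hne' : (⇑(hA.eigenvectorBasis k) : Fin 3 → ℝ) ≠ 0 := by
      intro h0
      apply hne
      ext i
      exact congrFun h0 i
    exact (smul_left_injective ℝ hne' h2).symm
  by_contra hd
  have hne : ∀ i j, i ≠ j → eigsN A i ≠ eigsN A j := fun i j hij he => hd ⟨i, j, hij, he⟩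
  have h01 := sub_ne_zero.mpr (hne 0 1 (by decide))
  have h02 := sub_ne_zero.mpr (hne 0 2 (by decide))
  have h12 := sub_ne_zero.mpr (hne 1 2 (by decide))
  have e1 : eigsN A 0 + eigsN A 1 - s = 0 := by
    apply mul_left_cancel₀ h01
    linear_combination key 0 - key 1
  have e2 : eigsN A 0 + eigsN A 2 - s = 0 := by
    apply mul_left_cancel₀ h02
    linear_combination key 0 - key 2
  apply h12
  linear_combination e1 - e2

theorem quad_of_degen (A : ↥(symTraceless 3)) (h : Degen A) : ∃ s t : ℝ,
    A.1 * A.1 = s • A.1 + t • (1 : Matrix (Fin 3) (Fin 3) ℝ) := by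
  have hA := isHermitian_of_isSymm (mem_symTraceless.mp A.2).1
  obtain ⟨s, t, hst⟩ : ∃ s t : ℝ, ∀ k, eigsN A k * eigsN A k = s * eigsN A k + t := by
    obtain ⟨i, j, hij, he⟩ := h
    obtain ⟨l, hl⟩ : ∃ l : Fin 3, ∀ k, k = i ∨ k = j ∨ k = l := by
      revert hij; clear he; revert i j; decide
    refine ⟨eigsN A i + eigsN A l, - eigsN A i * eigsN A l, fun k => ?_⟩
    rcases hl k with rfl | rfl | rfl
    · ring
    · rw [he]; ring
    · ring
  refine ⟨s, t, ?_⟩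
  have hD : diagonal (RCLike.ofReal ∘ hA.eigenvalues : Fin 3 → ℝ) *
      diagonal (RCLike.ofReal ∘ hA.eigenvalues) =
      s • diagonal (RCLike.ofReal ∘ hA.eigenvalues) + t • (1 : Matrix (Fin 3) (Fin 3) ℝ) := by
    rw [Matrix.diagonal_mul_diagonal, ← Matrix.diagonal_one, ← Matrix.diagonal_smul,
      ← Matrix.diagonal_smul, Matrix.diagonal_add]
    congr 1
    ext k
    have hk : hA.eigenvalues k * hA.eigenvalues k = s * hA.eigenvalues k + t := hst k
    simpa using hk
  have h2 := congrArg (Unitary.conjStarAlgAut ℝ _ hA.eigenvectorUnitary) hD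
  rw [map_mul, map_add, map_smul, map_smul, map_one, ← hA.spectral_theorem] at h2
  exact h2

def wfun (i : Fin 7) (A : ↥(symTraceless 3)) : ℝ :=
  wpoly (A.1 0 0) (A.1 1 1) (A.1 1 2) (A.1 0 2) (A.1 0 1) i

theorem entries (A : ↥(symTraceless 3)) : A.1 1 0 = A.1 0 1 ∧ A.1 2 0 = A.1 0 2 ∧
    A.1 2 1 = A.1 1 2 ∧ A.1 2 2 = - A.1 0 0 - A.1 1 1 := by
  obtain ⟨h1, h2⟩ := mem_symTraceless.mp A.2
  refine ⟨h1.apply 0 1, h1.apply 0 2, h1.apply 1 2, ?_⟩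
  rw [Matrix.trace_fin_three] at h2
  linarith

def mkN (a b x y z : ℝ) : ↥(symTraceless 3) :=
  ⟨!![a, z, y; z, b, x; y, x, -a-b], by
    refine mem_symTraceless.mpr ⟨?_, ?_⟩
    · ext i j
      fin_cases i <;> fin_cases j <;> rfl
    · rw [Matrix.trace_fin_three]
      simp⟩

theorem wfun_mkN (i : Fin 7) (a b x y z : ℝ) : wfun i (mkN a b x y z) = wpoly a b x y z i := rfl

theorem lin_eval (q : MvPolynomial (Fin 3 × Fin 3) ℝ)
    (hq : q ∈ MvPolynomial.homogeneousSubmodule (Fin 3 × Fin 3) ℝ 1) :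
    ∃ l : Fin 5 → ℝ, ∀ A : ↥(symTraceless 3), evalMat q A.1 =
      l 0*A.1 0 0+l 1*A.1 1 1+l 2*A.1 1 2+l 3*A.1 0 2+l 4*A.1 0 1 := by
  rw [MvPolynomial.homogeneousSubmodule_one_eq_span_X] at hq
  induction hq using Submodule.span_induction with
  | mem x hx =>
    obtain ⟨⟨i, j⟩, rfl⟩ := hx
    have : ∃ l : Fin 5 → ℝ, ∀ A : ↥(symTraceless 3), A.1 i j =
      l 0*A.1 0 0+l 1*A.1 1 1+l 2*A.1 1 2+l 3*A.1 0 2+l 4*A.1 0 1 := by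
      fin_cases i <;> fin_cases j
      · exact ⟨![1,0,0,0,0], fun A => by simp⟩
      · exact ⟨![0,0,0,0,1], fun A => by simp⟩
      · exact ⟨![0,0,0,1,0], fun A => by simp⟩
      · exact ⟨![0,0,0,0,1], fun A => by simp [(entries A).1]⟩
      · exact ⟨![0,1,0,0,0], fun A => by simp⟩
      · exact ⟨![0,0,1,0,0], fun A => by simp⟩
      · exact ⟨![0,0,0,1,0], fun A => by simp [(entries A).2.1]⟩
      · exact ⟨![0,0,1,0,0], fun A => by simp [(entries A).2.2.1]⟩
      · exact ⟨![-1,-1,0,0,0], fun A => by simp [(entries A).2.2.2]; ring⟩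
    simpa [evalMat] using this
  | zero => exact ⟨0, fun A => by simp [evalMat]⟩
  | add x y _ _ hx hy =>
    obtain ⟨l, hl⟩ := hx
    obtain ⟨m, hm⟩ := hy
    refine ⟨l + m, fun A => ?_⟩
    have h1 := hl A
    have h2 := hm A
    simp only [evalMat, map_add, Pi.add_apply] at *
    rw [h1, h2]; ring
  | smul c x _ hx =>
    obtain ⟨l, hl⟩ := hx
    refine ⟨c • l, fun A => ?_⟩
    have h1 := hl A
    simp only [evalMat, MvPolynomial.smul_eval, Pi.smul_apply, smul_eq_mul] at *
    rw [h1]; ring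

theorem cub_add (d e : Fin 35 → ℝ) (a b x y z : ℝ) :
    cub (d + e) a b x y z = cub d a b x y z + cub e a b x y z := by
  simp only [cub, Pi.add_apply]; ring

theorem cub_eval (p : MvPolynomial (Fin 3 × Fin 3) ℝ) (hp : p.IsHomogeneous 3) :
    ∃ d : Fin 35 → ℝ, ∀ A : ↥(symTraceless 3), evalMat p A.1 =
      cub d (A.1 0 0) (A.1 1 1) (A.1 1 2) (A.1 0 2) (A.1 0 1) := by
  have hp' : p ∈ MvPolynomial.homogeneousSubmodule (Fin 3 × Fin 3) ℝ 3 := hp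
  rw [← MvPolynomial.homogeneousSubmodule_one_pow, pow_succ, pow_two] at hp'
  clear hp
  induction hp' using Submodule.mul_induction_on' with
  | mem_mul_mem r hr n hn =>
    obtain ⟨n', hn'⟩ := lin_eval n hn
    induction hr using Submodule.mul_induction_on' with
    | mem_mul_mem l hl m hm =>
      obtain ⟨l', hl'⟩ := lin_eval l hl
      obtain ⟨m', hm'⟩ := lin_eval m hm
      obtain ⟨d, hd⟩ := cub_prod l' m' n'
      refine ⟨d, fun A => ?_⟩
      rw [← hd, ← hl', ← hm', ← hn']
      simp [evalMat]
    | add u _ v _ hu hv =>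
      obtain ⟨d, hd⟩ := hu
      obtain ⟨e, he⟩ := hv
      refine ⟨d + e, fun A => ?_⟩
      rw [cub_add, ← hd, ← he]
      simp [evalMat, add_mul]
  | add u _ v _ hu hv =>
      obtain ⟨d, hd⟩ := hu
      obtain ⟨e, he⟩ := hv
      refine ⟨d + e, fun A => ?_⟩
      rw [cub_add, ← hd, ← he]
      simp [evalMat]

theorem wfun_mem (i : Fin 7) : wfun i ∈ idealF3 := by
  refine ⟨?_, ?_⟩
  · let a : MvPolynomial (Fin 3 × Fin 3) ℝ := MvPolynomial.X (0, 0)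
    let b : MvPolynomial (Fin 3 × Fin 3) ℝ := MvPolynomial.X (1, 1)
    let x : MvPolynomial (Fin 3 × Fin 3) ℝ := MvPolynomial.X (1, 2)
    let y : MvPolynomial (Fin 3 × Fin 3) ℝ := MvPolynomial.X (0, 2)
    let z : MvPolynomial (Fin 3 × Fin 3) ℝ := MvPolynomial.X (0, 1)
    have ha : a.IsHomogeneous 1 := MvPolynomial.isHomogeneous_X _ _
    have hb : b.IsHomogeneous 1 := MvPolynomial.isHomogeneous_X _ _
    have hx : x.IsHomogeneous 1 := MvPolynomial.isHomogeneous_X _ _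
    have hy : y.IsHomogeneous 1 := MvPolynomial.isHomogeneous_X _ _
    have hz : z.IsHomogeneous 1 := MvPolynomial.isHomogeneous_X _ _
    have hc : (-a-b).IsHomogeneous 1 := ha.neg.sub hb
    fin_cases i
    · refine ⟨(a-b)*(a*a+z*z-(-a-b)*(-a-b)-x*x)-(a-(-a-b))*(a*a+y*y-b*b-x*x), ?_, fun A => ?_⟩
      · exact ((ha.sub hb).mul ((((ha.mul ha).add (hz.mul hz)).sub (hc.mul hc)).sub (hx.mul hx))).sub
          ((ha.sub hc).mul ((((ha.mul ha).add (hy.mul hy)).sub (hb.mul hb)).sub (hx.mul hx)))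
      · simp [wfun, wpoly, evalMat, a, b, x, y, z]
    · refine ⟨(b-(-a-b))*y*z+x*(y*y-z*z), ?_, fun A => ?_⟩
      · exact (((hb.sub hc).mul hy).mul hz).add (hx.mul ((hy.mul hy).sub (hz.mul hz)))
      · simp [wfun, wpoly, evalMat, a, b, x, y, z]
    · refine ⟨(a-b)*y*z-x*(a-b)*(a-(-a-b))+x*(x*x-y*y), ?_, fun A => ?_⟩
      · exact ((((ha.sub hb).mul hy).mul hz).sub ((hx.mul (ha.sub hb)).mul (ha.sub hc))).add
          (hx.mul ((hx.mul hx).sub (hy.mul hy)))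
      · simp [wfun, wpoly, evalMat, a, b, x, y, z]
    · refine ⟨((-a-b)-a)*z*x+y*(z*z-x*x), ?_, fun A => ?_⟩
      · exact (((hc.sub ha).mul hz).mul hx).add (hy.mul ((hz.mul hz).sub (hx.mul hx)))
      · simp [wfun, wpoly, evalMat, a, b, x, y, z]
    · refine ⟨(b-(-a-b))*z*x-y*(b-(-a-b))*(b-a)+y*(y*y-z*z), ?_, fun A => ?_⟩
      · exact ((((hb.sub hc).mul hz).mul hx).sub ((hy.mul (hb.sub hc)).mul (hb.sub ha))).add
          (hy.mul ((hy.mul hy).sub (hz.mul hz)))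
      · simp [wfun, wpoly, evalMat, a, b, x, y, z]
    · refine ⟨(a-b)*x*y+z*(x*x-y*y), ?_, fun A => ?_⟩
      · exact (((ha.sub hb).mul hx).mul hy).add (hz.mul ((hx.mul hx).sub (hy.mul hy)))
      · simp [wfun, wpoly, evalMat, a, b, x, y, z]
    · refine ⟨((-a-b)-a)*x*y-z*((-a-b)-a)*((-a-b)-b)+z*(z*z-x*x), ?_, fun A => ?_⟩
      · exact ((((hc.sub ha).mul hx).mul hy).sub ((hz.mul (hc.sub ha)).mul (hc.sub hb))).add
          (hz.mul ((hz.mul hz).sub (hx.mul hx)))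
      · simp [wfun, wpoly, evalMat, a, b, x, y, z]
  · intro A hA
    obtain ⟨s, t, h⟩ := quad_of_degen A hA
    obtain ⟨h10, h20, h21, h22⟩ := entries A
    have h' : ∀ i j, (A.1 * A.1) i j = (s • A.1 + t • (1 : Matrix (Fin 3) (Fin 3) ℝ)) i j := by
      intro i j; rw [h]
    have k00 := h' 0 0
    have k11 := h' 1 1
    have k22 := h' 2 2
    have k01 := h' 0 1
    have k02 := h' 0 2
    have k12 := h' 1 2
    simp [Matrix.mul_apply, Fin.sum_univ_three, h10, h20, h21, h22] at k00 k11 k22 k01 k02 k12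
    unfold wfun
    generalize A.1 0 0 = a at *
    generalize A.1 1 1 = b at *
    generalize A.1 1 2 = x at *
    generalize A.1 0 2 = y at *
    generalize A.1 0 1 = z at *
    fin_cases i <;> simp [wpoly]
    · linear_combination (a-b)*(k00-k22) - (a-(-a-b))*(k00-k11)
    · linear_combination (b-(-a-b))*k12 - x*(k11-k22)
    · linear_combination (a-b)*k12 - x*(k00-k11)
    · linear_combination ((-a-b)-a)*k02 - y*(k22-k00)
    · linear_combination (b-(-a-b))*k02 - y*(k11-k22)
    · linear_combination (a-b)*k01 - z*(k00-k11)
    · linear_combination ((-a-b)-a)*k01 - z*(k22-k00)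

theorem idealF3_eq : idealF3 = Submodule.span ℝ (Set.range wfun) := by
  apply le_antisymm
  · rintro f ⟨⟨p, hp, hf⟩, hv⟩
    obtain ⟨d, hd⟩ := cub_eval p hp
    obtain ⟨c, hc⟩ := cub_solve d (by
      intro p q r
      have hdeg : Degen (mkN (3*p^2-(p^2+q^2+r^2)) (3*q^2-(p^2+q^2+r^2)) (3*q*r) (3*p*r) (3*p*q)) := by
        apply degen_of_quad _ (p^2+q^2+r^2) (2*(p^2+q^2+r^2)^2)
        ext i j
        fin_cases i <;> fin_cases j <;>
          simp [mkN, Matrix.mul_apply, Fin.sum_univ_three] <;> ring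
      have := hv _ hdeg
      rw [hf, hd] at this
      exact this)
    rw [Submodule.mem_span_range_iff_exists_fun]
    refine ⟨c, ?_⟩
    ext A
    rw [hf, hd, hc, Finset.sum_apply]
    rfl
  · rw [Submodule.span_le]
    rintro _ ⟨i, rfl⟩
    exact wfun_mem i

def prs : Fin 23 → Fin 7 × Fin 7 :=
  ![(0,0),(0,2),(0,4),(0,6),(1,3),(1,4),(1,5),(1,6),(2,2),(2,3),(2,4),(2,5),(2,6),(3,3),(3,4),
    (3,5),(3,6),(4,4),(4,5),(4,6),(5,5),(5,6),(6,6)]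

def pfun (k : Fin 23) : ↥(symTraceless 3) → ℝ := wfun (prs k).1 * wfun (prs k).2

theorem rels : wfun 0 * wfun 1 = wfun 3 * wfun 5 + wfun 3 * wfun 6 + wfun 4 * wfun 6 ∧
    wfun 0 * wfun 3 = wfun 1 * wfun 5 + wfun 2 * wfun 5 + wfun 2 * wfun 6 ∧
    wfun 0 * wfun 5 = wfun 1 * wfun 3 + wfun 1 * wfun 4 + wfun 2 * wfun 4 ∧
    wfun 1 * wfun 1 = - (wfun 3 * wfun 4) + wfun 5 * wfun 5 + wfun 5 * wfun 6 ∧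
    wfun 1 * wfun 2 = wfun 3 * wfun 3 + wfun 3 * wfun 4 - wfun 5 * wfun 5 := by
  refine ⟨?_, ?_, ?_, ?_, ?_⟩ <;> ext A <;> simp [wfun, wpoly] <;> ring

theorem pfun_mem (k : Fin 23) : pfun k ∈ Submodule.span ℝ (Set.range pfun) :=
  Submodule.subset_span ⟨k, rfl⟩

theorem wprod_mem (i j : Fin 7) : wfun i * wfun j ∈ Submodule.span ℝ (Set.range pfun) := by
  wlog hij : i ≤ j generalizing i j
  · rw [mul_comm]; exact this j i (le_of_not_ge hij)
  have hc : (∃ k, prs k = (i, j)) ∨ (i = 0 ∧ j = 1) ∨ (i = 0 ∧ j = 3) ∨ (i = 0 ∧ j = 5) ∨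
      (i = 1 ∧ j = 1) ∨ (i = 1 ∧ j = 2) := by
    revert i j; decide
  obtain ⟨r1, r2, r3, r4, r5⟩ := rels
  rcases hc with ⟨k, hk⟩ | ⟨rfl, rfl⟩ | ⟨rfl, rfl⟩ | ⟨rfl, rfl⟩ | ⟨rfl, rfl⟩ | ⟨rfl, rfl⟩
  · have := pfun_mem k
    rwa [pfun, hk] at this
  · rw [r1]; exact add_mem (add_mem (pfun_mem 15) (pfun_mem 16)) (pfun_mem 19)
  · rw [r2]; exact add_mem (add_mem (pfun_mem 6) (pfun_mem 11)) (pfun_mem 12)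
  · rw [r3]; exact add_mem (add_mem (pfun_mem 4) (pfun_mem 5)) (pfun_mem 10)
  · rw [r4]; exact add_mem (add_mem (neg_mem (pfun_mem 14)) (pfun_mem 20)) (pfun_mem 21)
  · rw [r5]; exact sub_mem (add_mem (pfun_mem 13) (pfun_mem 14)) (pfun_mem 20)

theorem span_eq : Submodule.span ℝ {h : ↥(symTraceless 3) → ℝ |
      ∃ f ∈ idealF3, ∃ g ∈ idealF3, h = f * g} = Submodule.span ℝ (Set.range pfun) := by
  apply le_antisymm
  · rw [Submodule.span_le]
    rintro _ ⟨f, hf, g, hg, rfl⟩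
    have h := Submodule.mul_mem_mul hf hg
    rw [idealF3_eq, Submodule.span_mul_span] at h
    refine (Submodule.span_le.mpr ?_) h
    rintro _ ⟨_, ⟨i, rfl⟩, _, ⟨j, rfl⟩, rfl⟩
    exact wprod_mem i j
  · rw [Submodule.span_le]
    rintro _ ⟨k, rfl⟩
    exact Submodule.subset_span ⟨_, wfun_mem _, _, wfun_mem _, rfl⟩

theorem wfun_indep : LinearIndependent ℝ wfun := by
  rw [Fintype.linearIndependent_iff]
  intro c hc
  have h : ∀ a b x y z : ℝ, ∑ i, c i * wfun i (mkN a b x y z) = 0 := by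
    intro a b x y z
    have := congrFun hc (mkN a b x y z)
    rw [Finset.sum_apply] at this
    exact this
  have h0 : (1)*c 6 = 0 := by
    have := h 0 0 0 0 1
    simp [Fin.sum_univ_succ, wfun_mkN, wpoly] at this
    linarith
  have h1 : (1)*c 4 = 0 := by
    have := h 0 0 0 1 0
    simp [Fin.sum_univ_succ, wfun_mkN, wpoly] at this
    linarith
  have h2 : (1)*c 2 = 0 := by
    have := h 0 0 1 0 0
    simp [Fin.sum_univ_succ, wfun_mkN, wpoly] at this
    linarith
  have h3 : (2)*c 0 = 0 := by
    have := h 0 1 0 0 0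
    simp [Fin.sum_univ_succ, wfun_mkN, wpoly] at this
    linarith
  have h4 : (1)*c 3 + (-1)*c 5 + (1)*c 6 = 0 := by
    have := h 0 0 0 1 1
    simp [Fin.sum_univ_succ, wfun_mkN, wpoly] at this
    linarith
  have h5 : (-1)*c 1 + (1)*c 2 + (1)*c 5 = 0 := by
    have := h 0 0 1 0 1
    simp [Fin.sum_univ_succ, wfun_mkN, wpoly] at this
    linarith
  have h6 : (1)*c 1 + (-1)*c 2 + (1)*c 5 = 0 := by
    have := h 0 0 (-1) 0 1
    simp [Fin.sum_univ_succ, wfun_mkN, wpoly] at this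
    linarith
  have g0 : c 0 = 0 := by linear_combination (1/2)*h3
  have g1 : c 1 = 0 := by linear_combination (1)*h2 + (-1/2)*h5 + (1/2)*h6
  have g2 : c 2 = 0 := by linear_combination (1)*h2
  have g3 : c 3 = 0 := by linear_combination (-1)*h0 + (1)*h4 + (1/2)*h5 + (1/2)*h6
  have g4 : c 4 = 0 := by linear_combination (1)*h1
  have g5 : c 5 = 0 := by linear_combination (1/2)*h5 + (1/2)*h6
  have g6 : c 6 = 0 := by linear_combination (1)*h0
  intro i
  fin_cases i
  · exact g0
  · exact g1
  · exact g2
  · exact g3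
  · exact g4
  · exact g5
  · exact g6

theorem pfun_indep : LinearIndependent ℝ pfun := by
  rw [Fintype.linearIndependent_iff]
  intro c hc
  have h : ∀ a b x y z : ℝ, ∑ i, c i * pfun i (mkN a b x y z) = 0 := by
    intro a b x y z
    have := congrFun hc (mkN a b x y z)
    rw [Finset.sum_apply] at this
    exact this
  have h0 : (1)*c 22 = 0 := by
    have := h 0 0 0 0 1
    simp [Fin.sum_univ_succ, pfun, prs, wfun_mkN, wpoly] at this
    linarith
  have h1 : (1)*c 17 = 0 := by
    have := h 0 0 0 1 0
    simp [Fin.sum_univ_succ, pfun, prs, wfun_mkN, wpoly] at this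
    linarith
  have h2 : (1)*c 8 = 0 := by
    have := h 0 0 1 0 0
    simp [Fin.sum_univ_succ, pfun, prs, wfun_mkN, wpoly] at this
    linarith
  have h3 : (4)*c 0 = 0 := by
    have := h 0 1 0 0 0
    simp [Fin.sum_univ_succ, pfun, prs, wfun_mkN, wpoly] at this
    linarith
  have h4 : (1)*c 0 + (-1)*c 3 + (1)*c 22 = 0 := by
    have := h 0 1 0 0 1
    simp [Fin.sum_univ_succ, pfun, prs, wfun_mkN, wpoly] at this
    linarith
  have h5 : (1)*c 0 + (-1)*c 2 + (1)*c 17 = 0 := by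
    have := h 0 1 0 1 0
    simp [Fin.sum_univ_succ, pfun, prs, wfun_mkN, wpoly] at this
    linarith
  have h6 : (16)*c 0 + (8)*c 1 + (4)*c 8 = 0 := by
    have := h 0 1 1 0 0
    simp [Fin.sum_univ_succ, pfun, prs, wfun_mkN, wpoly] at this
    linarith
  have h7 : (1)*c 13 + (-1)*c 15 + (1)*c 16 + (1)*c 20 + (-1)*c 21 + (1)*c 22 = 0 := by
    have := h 0 0 0 1 1
    simp [Fin.sum_univ_succ, pfun, prs, wfun_mkN, wpoly] at this
    linarith
  have h8 : (-1)*c 6 + (1)*c 8 + (1)*c 11 + (1)*c 20 = 0 := by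
    have := h 0 0 1 0 1
    simp [Fin.sum_univ_succ, pfun, prs, wfun_mkN, wpoly] at this
    linarith
  have h9 : (-1)*c 4 + (1)*c 5 + (1)*c 13 + (-1)*c 14 + (1)*c 17 = 0 := by
    have := h 0 0 1 1 0
    simp [Fin.sum_univ_succ, pfun, prs, wfun_mkN, wpoly] at this
    linarith
  have h10 : (1)*c 6 + (1)*c 8 + (-1)*c 11 + (1)*c 20 = 0 := by
    have := h 0 0 (-1) 0 1
    simp [Fin.sum_univ_succ, pfun, prs, wfun_mkN, wpoly] at this
    linarith
  have h11 : (1)*c 4 + (-1)*c 5 + (1)*c 13 + (-1)*c 14 + (1)*c 17 = 0 := by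
    have := h 0 0 (-1) 1 0
    simp [Fin.sum_univ_succ, pfun, prs, wfun_mkN, wpoly] at this
    linarith
  have h12 : (1)*c 13 + (1)*c 15 + (-1)*c 16 + (1)*c 20 + (-1)*c 21 + (1)*c 22 = 0 := by
    have := h 0 0 0 (-1) 1
    simp [Fin.sum_univ_succ, pfun, prs, wfun_mkN, wpoly] at this
    linarith
  have h13 : (16)*c 13 + (-12)*c 14 + (-8)*c 15 + (32)*c 16 + (9)*c 17 + (6)*c 18 + (-24)*c 19 + (4)*c 20 + (-16)*c 21 + (64)*c 22 = 0 := by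
    have := h 0 0 0 1 2
    simp [Fin.sum_univ_succ, pfun, prs, wfun_mkN, wpoly] at this
    linarith
  have h14 : (4)*c 13 + (12)*c 14 + (-8)*c 15 + (2)*c 16 + (36)*c 17 + (-24)*c 18 + (6)*c 19 + (16)*c 20 + (-4)*c 21 + (1)*c 22 = 0 := by
    have := h 0 0 0 2 1
    simp [Fin.sum_univ_succ, pfun, prs, wfun_mkN, wpoly] at this
    linarith
  have h15 : (-8)*c 6 + (-24)*c 7 + (1)*c 8 + (2)*c 11 + (6)*c 12 + (4)*c 20 + (12)*c 21 + (36)*c 22 = 0 := by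
    have := h 0 0 1 0 2
    simp [Fin.sum_univ_succ, pfun, prs, wfun_mkN, wpoly] at this
    linarith
  have h16 : (-8)*c 4 + (32)*c 5 + (9)*c 8 + (6)*c 9 + (-24)*c 10 + (4)*c 13 + (-16)*c 14 + (64)*c 17 = 0 := by
    have := h 0 0 1 2 0
    simp [Fin.sum_univ_succ, pfun, prs, wfun_mkN, wpoly] at this
    linarith
  have h17 : (-8)*c 6 + (6)*c 7 + (64)*c 8 + (32)*c 11 + (-24)*c 12 + (16)*c 20 + (-12)*c 21 + (9)*c 22 = 0 := by
    have := h 0 0 2 0 1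
    simp [Fin.sum_univ_succ, pfun, prs, wfun_mkN, wpoly] at this
    linarith
  have h18 : (-8)*c 4 + (2)*c 5 + (36)*c 8 + (-24)*c 9 + (6)*c 10 + (16)*c 13 + (-4)*c 14 + (1)*c 17 = 0 := by
    have := h 0 0 2 1 0
    simp [Fin.sum_univ_succ, pfun, prs, wfun_mkN, wpoly] at this
    linarith
  have h19 : (8)*c 6 + (-6)*c 7 + (64)*c 8 + (-32)*c 11 + (24)*c 12 + (16)*c 20 + (-12)*c 21 + (9)*c 22 = 0 := by
    have := h 0 0 (-2) 0 1
    simp [Fin.sum_univ_succ, pfun, prs, wfun_mkN, wpoly] at this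
    linarith
  have h20 : (1)*c 0 + (1)*c 4 + (-1)*c 6 + (1)*c 13 + (-1)*c 15 + (1)*c 20 = 0 := by
    have := h 1 0 1 1 2
    simp [Fin.sum_univ_succ, pfun, prs, wfun_mkN, wpoly] at this
    linarith
  have h21 : (1)*c 0 + (-1)*c 4 + (1)*c 6 + (1)*c 13 + (-1)*c 15 + (1)*c 20 = 0 := by
    have := h 0 (-1) 1 2 1
    simp [Fin.sum_univ_succ, pfun, prs, wfun_mkN, wpoly] at this
    linarith
  have h22 : (1)*c 0 + (1)*c 4 + (1)*c 6 + (1)*c 13 + (1)*c 15 + (1)*c 20 = 0 := by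
    have := h 0 1 1 (-2) 1
    simp [Fin.sum_univ_succ, pfun, prs, wfun_mkN, wpoly] at this
    linarith
  have g0 : c 0 = 0 := by linear_combination (1/4)*h3
  have g1 : c 1 = 0 := by linear_combination (-1/2)*h2 + (-1/2)*h3 + (1/8)*h6
  have g2 : c 2 = 0 := by linear_combination (1)*h1 + (1/4)*h3 + (-1)*h5
  have g3 : c 3 = 0 := by linear_combination (1)*h0 + (1/4)*h3 + (-1)*h4
  have g4 : c 4 = 0 := by linear_combination (1/4)*h0 + (-4)*h2 + (-1/4)*h3 + (-1/2)*h7 + (-2/3)*h8 + (-2/3)*h10 + (-1/2)*h12 + (1/24)*h17 + (1/24)*h19 + (1/2)*h20 + (1/2)*h22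
  have g5 : c 5 = 0 := by linear_combination (1/4)*h0 + (-4)*h2 + (-1/4)*h3 + (-1/2)*h7 + (-2/3)*h8 + (1/2)*h9 + (-2/3)*h10 + (-1/2)*h11 + (-1/2)*h12 + (1/24)*h17 + (1/24)*h19 + (1/2)*h20 + (1/2)*h22
  have g6 : c 6 = 0 := by linear_combination (1/4)*h0 + (-4)*h2 + (-1/4)*h3 + (-1/2)*h7 + (-2/3)*h8 + (-2/3)*h10 + (-1/2)*h12 + (1/24)*h17 + (1/24)*h19 + (1/2)*h21 + (1/2)*h22
  have g7 : c 7 = 0 := by linear_combination (2)*h0 + (2)*h2 + (2/3)*h8 + (2/9)*h10 + (-2/45)*h15 + (-1/36)*h17 + (-1/60)*h19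
  have g8 : c 8 = 0 := by linear_combination (1)*h2
  have g9 : c 9 = 0 := by linear_combination (-1/10)*h0 + (2/5)*h1 + (37/10)*h2 + (1/5)*h7 + (1/15)*h8 + (2/5)*h9 + (1/15)*h10 + (-2/45)*h11 + (1/5)*h12 + (-1/90)*h16 + (-1/60)*h17 + (-2/45)*h18 + (-1/60)*h19
  have g10 : c 10 = 0 := by linear_combination (7/20)*h0 + (21/10)*h1 + (-26/5)*h2 + (-1/4)*h3 + (-7/10)*h7 + (-11/15)*h8 + (11/10)*h9 + (-11/15)*h10 + (-31/90)*h11 + (-7/10)*h12 + (-2/45)*h16 + (7/120)*h17 + (-1/90)*h18 + (7/120)*h19 + (1/2)*h20 + (1/2)*h22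
  have g11 : c 11 = 0 := by linear_combination (1/4)*h0 + (-4)*h2 + (-1/4)*h3 + (-1/2)*h7 + (-1/6)*h8 + (-7/6)*h10 + (-1/2)*h12 + (1/24)*h17 + (1/24)*h19 + (1/2)*h21 + (1/2)*h22
  have g12 : c 12 = 0 := by linear_combination (3/4)*h0 + (-7/2)*h2 + (-1/4)*h3 + (-1/2)*h7 + (1/6)*h8 + (-23/18)*h10 + (-1/2)*h12 + (-1/90)*h15 + (1/72)*h17 + (7/120)*h19 + (1/2)*h21 + (1/2)*h22
  have g13 : c 13 = 0 := by linear_combination (-1/4)*h0 + (5)*h2 + (1/2)*h7 + (1/6)*h8 + (1/6)*h10 + (1/2)*h12 + (-1/24)*h17 + (-1/24)*h19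
  have g14 : c 14 = 0 := by linear_combination (-1/4)*h0 + (1)*h1 + (5)*h2 + (1/2)*h7 + (1/6)*h8 + (-1/2)*h9 + (1/6)*h10 + (-1/2)*h11 + (1/2)*h12 + (-1/24)*h17 + (-1/24)*h19
  have g15 : c 15 = 0 := by linear_combination (-1/4)*h0 + (4)*h2 + (1/4)*h3 + (1/2)*h7 + (2/3)*h8 + (2/3)*h10 + (1/2)*h12 + (-1/24)*h17 + (-1/24)*h19 + (-1/2)*h20 + (-1/2)*h21
  have g16 : c 16 = 0 := by linear_combination (-1/4)*h0 + (4)*h2 + (1/4)*h3 + (1)*h7 + (2/3)*h8 + (2/3)*h10 + (-1/24)*h17 + (-1/24)*h19 + (-1/2)*h20 + (-1/2)*h21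
  have g17 : c 17 = 0 := by linear_combination (1)*h1
  have g18 : c 18 = 0 := by linear_combination (3/10)*h0 + (21/10)*h1 + (8/5)*h2 + (3/5)*h7 + (4/15)*h8 + (-1/5)*h9 + (4/15)*h10 + (-1/5)*h11 + (7/45)*h12 + (-1/90)*h13 + (-2/45)*h14 + (-1/60)*h17 + (-1/60)*h19
  have g19 : c 19 = 0 := by linear_combination (39/20)*h0 + (2/5)*h1 + (12/5)*h2 + (1/4)*h3 + (7/5)*h7 + (2/5)*h8 + (1/5)*h9 + (2/5)*h10 + (1/5)*h11 + (-2/45)*h12 + (-2/45)*h13 + (-1/90)*h14 + (-1/40)*h17 + (-1/40)*h19 + (-1/2)*h20 + (-1/2)*h21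
  have g20 : c 20 = 0 := by linear_combination (-1)*h2 + (1/2)*h8 + (1/2)*h10
  have g21 : c 21 = 0 := by linear_combination (3/4)*h0 + (4)*h2 + (2/3)*h8 + (2/3)*h10 + (-1/24)*h17 + (-1/24)*h19
  have g22 : c 22 = 0 := by linear_combination (1)*h0
  intro i
  fin_cases i
  · exact g0
  · exact g1
  · exact g2
  · exact g3
  · exact g4
  · exact g5
  · exact g6
  · exact g7
  · exact g8
  · exact g9
  · exact g10
  · exact g11
  · exact g12
  · exact g13
  · exact g14
  · exact g15
  · exact g16
  · exact g17
  · exact g18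
  · exact g19
  · exact g20
  · exact g21
  · exact g22

/-- For `n = 3`, with `W` the 7-dimensional space of degree-3 homogeneous polynomial
functions on `N` vanishing on the degenerate matrices, the multiplication map
`Sym²(W) → ℝ[N]` has 5-dimensional kernel; equivalently, the span of the products
`{f·g : f, g ∈ W}` has dimension `28 - 5 = 23`. -/
theorem span_products_idealF3_finrank :
    Module.finrank ℝ ↥idealF3 = 7 ∧
    Module.finrank ℝ ↥(Submodule.span ℝ {h : ↥(symTraceless 3) → ℝ |
      ∃ f ∈ idealF3, ∃ g ∈ idealF3, h = f * g}) = 23 := by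

  constructor
  · rw [idealF3_eq, finrank_span_eq_card wfun_indep, Fintype.card_fin]
  · rw [span_eq, finrank_span_eq_card pfun_indep, Fintype.card_fin]
end
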